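/- Let u₀ ∈ L^∞(ℝⁿ;ℝⁿ) be divergence-free and suppose the mild solution u of the Navier–Stokes equations with initial datum u₀ has maximal existence interval (0,T) with T < ∞; that is, u ∈ L^∞(ℝⁿ×(0,T'); ℝⁿ) is a mild solution for every T' < T, and ‖u‖_{L^∞(ℝⁿ×(0,T'))} → ∞ as T' ↗ T. Then for every p, q ∈ (1,∞) with n/p + 2/q = 1 one has ∫₀^T ‖u(·,t)‖_{L^p(ℝⁿ)}^q dt = +∞. -/

import Mathlib

open MeasureTheory Real Filter Topology

noncomputable section

/-- Euclidean space ℝⁿ. -/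
abbrev Euc (n : ℕ) := EuclideanSpace ℝ (Fin n)

/-- The heat kernel Γ(x,t) = (4πt)^{-n/2} exp(-|x|²/(4t)). -/
noncomputable def heatKer (n : ℕ) (x : Euc n) (t : ℝ) : ℝ :=
  (4 * π * t) ^ (-(n : ℝ) / 2) * Real.exp (-‖x‖ ^ 2 / (4 * t))

/-- The fundamental solution G of the Laplacian on ℝⁿ (n ≥ 2). -/
noncomputable def lapFund (n : ℕ) (x : Euc n) : ℝ :=
  if n = 2 then (2 * π)⁻¹ * Real.log ‖x‖
  else -((((n : ℝ) - 2) * (2 * π ^ ((n : ℝ) / 2) / Real.Gamma ((n : ℝ) / 2)))⁻¹) *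
      ‖x‖ ^ (2 - (n : ℝ))

/-- The generating function Φ(x,t) = ∫_{ℝⁿ} G(y) Γ(x-y,t) dy. -/
noncomputable def genPhi (n : ℕ) (x : Euc n) (t : ℝ) : ℝ :=
  ∫ y : Euc n, lapFund n y * heatKer n (x - y) t

/-- Spatial partial derivative ∂f/∂x_i of a scalar function on ℝⁿ. -/
noncomputable def pd (n : ℕ) (i : Fin n) (f : Euc n → ℝ) (x : Euc n) : ℝ :=
  fderiv ℝ f x (EuclideanSpace.single i 1)

/-- The Laplacian of a scalar function on ℝⁿ. -/
noncomputable def lap (n : ℕ) (f : Euc n → ℝ) (x : Euc n) : ℝ :=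
  ∑ i : Fin n, pd n i (pd n i f) x

/-- The Oseen kernel K_{ij} = (-δ_{ij}Δ + ∂²/∂x_i∂x_j)Φ. -/
noncomputable def Kmat (n : ℕ) (i j : Fin n) (x : Euc n) (t : ℝ) : ℝ :=
  (if i = j then -(lap n (fun y => genPhi n y t) x) else 0)
    + pd n i (pd n j (fun y => genPhi n y t)) x

/-- The kernel K_{ijk} = ∂K_{ij}/∂x_k. -/
noncomputable def Kten (n : ℕ) (i j k : Fin n) (x : Euc n) (t : ℝ) : ℝ :=
  pd n k (fun y => Kmat n i j y t) x

/-- Mild solution of the Navier–Stokes equations on ℝⁿ × (t₀,t₁) with initial datum u₀: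
u_i(x,t) = ∫ Γ(x-y,t-t₀) u₀ᵢ(y) dy - ∫_{t₀}^t ∫ K_{ijk}(x-y,t-s) u_k u_j dy ds. -/
def IsMildNS (n : ℕ) (t₀ t₁ : ℝ) (u₀ : Euc n → Euc n) (u : Euc n → ℝ → Euc n) : Prop :=
  ∀ x : Euc n, ∀ t : ℝ, t ∈ Set.Ioo t₀ t₁ → ∀ i : Fin n,
    u x t i = (∫ y : Euc n, heatKer n (x - y) (t - t₀) * u₀ y i)
      - ∫ s in Set.Ioo t₀ t, ∫ y : Euc n,
          ∑ j : Fin n, ∑ k : Fin n, Kten n i j k (x - y) (t - s) * u y s k * u y s j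

/-- Spatial partial derivative for functions on space-time ℝⁿ × ℝ. -/
noncomputable def pdx (n : ℕ) (i : Fin n) (g : Euc n × ℝ → ℝ) (p : Euc n × ℝ) : ℝ :=
  fderiv ℝ g p (EuclideanSpace.single i 1, 0)

/-- Time derivative for functions on space-time ℝⁿ × ℝ. -/
noncomputable def pdt (n : ℕ) (g : Euc n × ℝ → ℝ) (p : Euc n × ℝ) : ℝ :=
  fderiv ℝ g p (0, 1)

/-- Spatial Laplacian for functions on space-time ℝⁿ × ℝ. -/
noncomputable def lapx (n : ℕ) (g : Euc n × ℝ → ℝ) (p : Euc n × ℝ) : ℝ :=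
  ∑ i : Fin n, pdx n i (pdx n i g) p

lemma heatKer_nonneg (n : ℕ) (x : Euc n) {t : ℝ} (ht : 0 < t) : 0 ≤ heatKer n x t := by
  unfold heatKer; positivity

lemma measurable_heatKer (n : ℕ) : Measurable (fun z : Euc n × ℝ => heatKer n z.1 z.2) := by
  unfold heatKer; fun_prop

lemma integral_heatKer (n : ℕ) {t : ℝ} (ht : 0 < t) : ∫ x : Euc n, heatKer n x t = 1 := by
  have h := GaussianFourier.integral_rexp_neg_mul_sq_norm (V := Euc n)
    (b := (4 * t)⁻¹) (by positivity)
  unfold heatKer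
  rw [integral_const_mul]
  have e : ∀ x : Euc n, -‖x‖ ^ 2 / (4 * t) = -(4 * t)⁻¹ * ‖x‖ ^ 2 := fun x => by
    field_simp
  simp_rw [e, h]
  rw [finrank_euclideanSpace, Fintype.card_fin, div_inv_eq_mul,
    show π * (4 * t) = 4 * π * t by ring, ← Real.rpow_add (by positivity)]
  rw [show -(n : ℝ) / 2 + n / 2 = 0 by ring, Real.rpow_zero]

lemma integrable_heatKer (n : ℕ) {t : ℝ} (ht : 0 < t) :
    Integrable (fun x : Euc n => heatKer n x t) :=
  .of_integral_ne_zero (by rw [integral_heatKer n ht]; exact one_ne_zero)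

lemma integral_heatKer_sub (n : ℕ) (x : Euc n) {t : ℝ} (ht : 0 < t) :
    ∫ y : Euc n, heatKer n (x - y) t = 1 := by
  rw [integral_sub_left_eq_self (fun y => heatKer n y t), integral_heatKer n ht]

lemma integrable_heatKer_sub (n : ℕ) (x : Euc n) {t : ℝ} (ht : 0 < t) :
    Integrable (fun y : Euc n => heatKer n (x - y) t) :=
  (integrable_heatKer n ht).comp_sub_left x

lemma heatKer_mul_heatKer (n : ℕ) (x y : Euc n) {s t : ℝ} (hs : 0 < s) (ht : 0 < t) :
    heatKer n y s * heatKer n (x - y) t =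
      heatKer n x (s + t) * heatKer n ((s / (s + t)) • x - y) (s * t / (s + t)) := by
  unfold heatKer
  have h1 : (4 * π * s) ^ (-(n : ℝ) / 2) * (4 * π * t) ^ (-(n : ℝ) / 2) =
      (4 * π * (s + t)) ^ (-(n : ℝ) / 2) * (4 * π * (s * t / (s + t))) ^ (-(n : ℝ) / 2) := by
    rw [← Real.mul_rpow (by positivity) (by positivity),
      ← Real.mul_rpow (by positivity) (by positivity)]
    congr 1
    field_simp
  have h2 : -‖y‖ ^ 2 / (4 * s) + -‖x - y‖ ^ 2 / (4 * t) =
      -‖x‖ ^ 2 / (4 * (s + t)) +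
        -‖(s / (s + t)) • x - y‖ ^ 2 / (4 * (s * t / (s + t))) := by
    rw [norm_sub_sq_real, norm_sub_sq_real, norm_smul, inner_smul_left, mul_pow, Real.norm_eq_abs,
      sq_abs]
    simp only [conj_trivial]
    field_simp
    ring
  rw [mul_mul_mul_comm, h1, ← Real.exp_add, h2, Real.exp_add, mul_mul_mul_comm]

lemma integrable_heatKer_mul (n : ℕ) (x : Euc n) {s t : ℝ} (hs : 0 < s) (ht : 0 < t) :
    Integrable (fun y : Euc n => heatKer n y s * heatKer n (x - y) t) := by
  simp_rw [heatKer_mul_heatKer n x _ hs ht]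
  exact (integrable_heatKer_sub n _ (by positivity)).const_mul _

lemma integral_heatKer_mul (n : ℕ) (x : Euc n) {s t : ℝ} (hs : 0 < s) (ht : 0 < t) :
    ∫ y : Euc n, heatKer n y s * heatKer n (x - y) t = heatKer n x (s + t) := by
  simp_rw [heatKer_mul_heatKer n x _ hs ht]
  rw [integral_const_mul, integral_heatKer_sub n _ (by positivity), mul_one]

lemma integrable_sq_norm_mul_heatKer (n : ℕ) (x : Euc n) {t : ℝ} (ht : 0 < t) :
    Integrable (fun y : Euc n => ‖y‖ ^ 2 * heatKer n (x - y) t) := by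
  have key : ∀ z : Euc n, ‖z‖ ^ 2 * heatKer n z t ≤
      8 * t * 2 ^ ((n : ℝ) / 2) * heatKer n z (2 * t) := by
    intro z
    have e1 : (4 * π * t) ^ (-(n : ℝ) / 2) =
        2 ^ ((n : ℝ) / 2) * (4 * π * (2 * t)) ^ (-(n : ℝ) / 2) := by
      rw [show 4 * π * (2 * t) = 2 * (4 * π * t) by ring,
        Real.mul_rpow (x := 2) (by positivity) (by positivity), ← mul_assoc,
        ← Real.rpow_add (by positivity), show (n : ℝ) / 2 + -n / 2 = 0 by ring, Real.rpow_zero,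
        one_mul]
    have e2 : ‖z‖ ^ 2 * Real.exp (-‖z‖ ^ 2 / (4 * t)) ≤
        8 * t * Real.exp (-‖z‖ ^ 2 / (4 * (2 * t))) := by
      have : ‖z‖ ^ 2 / (8 * t) ≤ Real.exp (‖z‖ ^ 2 / (8 * t)) := by
        linarith [Real.add_one_le_exp (‖z‖ ^ 2 / (8 * t))]
      rw [show -‖z‖ ^ 2 / (4 * (2 * t)) = ‖z‖ ^ 2 / (8 * t) + -‖z‖ ^ 2 / (4 * t) by
        field_simp; ring, Real.exp_add, ← mul_assoc]
      gcongr
      rw [div_le_iff₀ (by positivity)] at this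
      linarith
    unfold heatKer
    rw [e1]
    calc _ = 2 ^ ((n : ℝ) / 2) * (4 * π * (2 * t)) ^ (-(n : ℝ) / 2) *
          (‖z‖ ^ 2 * Real.exp (-‖z‖ ^ 2 / (4 * t))) := by ring
      _ ≤ _ * (8 * t * Real.exp (-‖z‖ ^ 2 / (4 * (2 * t)))) := by gcongr
      _ = _ := by ring
  have hdom : Integrable (fun y : Euc n => 2 * ‖x‖ ^ 2 * heatKer n (x - y) t +
      2 * (8 * t * 2 ^ ((n : ℝ) / 2) * heatKer n (x - y) (2 * t))) :=
    ((integrable_heatKer_sub n x ht).const_mul _).add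
      (((integrable_heatKer_sub n x (by positivity)).const_mul _).const_mul _)
  refine hdom.mono' ?_ (Eventually.of_forall fun y => ?_)
  · exact ((continuous_norm.pow 2).measurable.mul ((measurable_heatKer n).comp
      (by fun_prop : Measurable fun y : Euc n => (x - y, t)))).aestronglyMeasurable
  · have h0 := heatKer_nonneg n (x - y) ht
    rw [Real.norm_of_nonneg (by positivity)]
    have h3 : ‖y‖ ^ 2 ≤ 2 * ‖x‖ ^ 2 + 2 * ‖x - y‖ ^ 2 := by
      have : ‖y‖ ≤ ‖x‖ + ‖x - y‖ := by
        calc ‖y‖ = ‖x - (x - y)‖ := by congr 1; abel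
          _ ≤ _ := norm_sub_le _ _
      nlinarith [norm_nonneg y, norm_nonneg x, norm_nonneg (x - y), sq_nonneg (‖x‖ - ‖x - y‖)]
    nlinarith [key (x - y)]

/-- The heat kernel at the origin, cut off for times at most one. -/
def heatCut (n : ℕ) (s : ℝ) : ℝ := if 1 < s then (4 * π * s) ^ (-(n : ℝ) / 2) else 0

/-- The heat kernel as a function of `r = |x|²`, renormalised by `heatCut`. -/
def heatProf (n : ℕ) (r s : ℝ) : ℝ :=
  (4 * π * s) ^ (-(n : ℝ) / 2) * Real.exp (-r / (4 * s)) - heatCut n s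

lemma measurable_heatCut (n : ℕ) : Measurable (heatCut n) := by
  unfold heatCut
  exact Measurable.ite measurableSet_Ioi (by fun_prop) measurable_const

lemma heatProf_norm_sq (n : ℕ) (x : Euc n) (s : ℝ) :
    heatProf n (‖x‖ ^ 2) s = heatKer n x s - heatCut n s := rfl

lemma rpow_heat_le_inv {n : ℕ} (hn : 2 ≤ n) {s : ℝ} (hs : 1 < s) :
    (4 * π * s) ^ (-(n : ℝ) / 2) ≤ s⁻¹ := by
  have hn' : (2 : ℝ) ≤ n := by exact_mod_cast hn
  have h4 : s ≤ 4 * π * s := by nlinarith [Real.pi_gt_three]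
  calc (4 * π * s) ^ (-(n : ℝ) / 2) ≤ (4 * π * s) ^ (-1 : ℝ) :=
        Real.rpow_le_rpow_of_exponent_le (by linarith) (by linarith)
    _ = (4 * π * s)⁻¹ := Real.rpow_neg_one _
    _ ≤ s⁻¹ := inv_anti₀ (by linarith) h4

lemma abs_heatProf_le {n : ℕ} (hn : 2 ≤ n) {r s : ℝ} (hr : 0 ≤ r) (hs : 1 < s) :
    |heatProf n r s| ≤ r * s ^ (-2 : ℝ) := by
  have hs0 : 0 < s := by linarith
  unfold heatProf heatCut
  rw [if_pos hs, ← mul_sub_one, abs_mul, abs_of_nonneg (by positivity)]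
  have h1 : |Real.exp (-r / (4 * s)) - 1| ≤ r / (4 * s) := by
    have : Real.exp (-r / (4 * s)) ≤ 1 :=
      Real.exp_le_one_iff.2 (div_nonpos_of_nonpos_of_nonneg (by linarith) (by positivity))
    rw [abs_of_nonpos (by linarith)]
    have := Real.add_one_le_exp (-r / (4 * s))
    rw [neg_div] at *
    linarith
  calc _ ≤ s⁻¹ * (r / (4 * s)) := by gcongr; exact rpow_heat_le_inv hn hs
    _ ≤ s⁻¹ * (r / s) := by gcongr; linarith
    _ = _ := by
      rw [show (-2 : ℝ) = ((-2 : ℤ) : ℝ) by norm_num, Real.rpow_intCast]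
      field_simp

lemma measurable_heatProf (n : ℕ) (r : ℝ) : Measurable (heatProf n r) := by
  unfold heatProf
  exact Measurable.sub (by fun_prop) (measurable_heatCut n)

lemma integrableOn_heatProf {n : ℕ} (hn : 2 ≤ n) {r : ℝ} (hr : 0 < r) :
    IntegrableOn (heatProf n r) (Set.Ioi 0) := by
  rw [← Set.Ioc_union_Ioi_eq_Ioi zero_le_one]
  refine IntegrableOn.union ?_ ?_
  · refine Integrable.mono' (g := fun _ => (n.factorial : ℝ) * (4 / r) ^ n)
      (integrableOn_const (by simp)) (measurable_heatProf n r).aestronglyMeasurable ?_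
    refine (ae_restrict_mem measurableSet_Ioc).mono fun s hs => ?_
    have hs0 := hs.1
    unfold heatProf heatCut
    rw [if_neg (not_lt.2 hs.2), sub_zero, Real.norm_of_nonneg (by positivity)]
    have h1 : (4 * π * s) ^ (-(n : ℝ) / 2) ≤ (s⁻¹) ^ n := by
      calc _ ≤ s ^ (-(n : ℝ) / 2) := by
            refine Real.rpow_le_rpow_of_nonpos hs0 (by nlinarith [Real.pi_gt_three]) ?_
            have : (0 : ℝ) ≤ n := by positivity
            linarith
        _ ≤ s ^ (-(n : ℝ)) := by
            refine Real.rpow_le_rpow_of_exponent_ge hs0 hs.2 ?_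
            have : (0 : ℝ) ≤ n := by positivity
            linarith
        _ = _ := by rw [Real.rpow_neg hs0.le, Real.rpow_natCast, inv_pow]
    have h2 : (r / (4 * s)) ^ n / n.factorial ≤ Real.exp (r / (4 * s)) :=
      Real.pow_div_factorial_le_exp _ (by positivity) n
    rw [div_le_iff₀ (by positivity)] at h2
    calc _ ≤ (s⁻¹) ^ n * Real.exp (-r / (4 * s)) := by gcongr
      _ = (4 / r) ^ n * ((r / (4 * s)) ^ n * Real.exp (-r / (4 * s))) := by
          rw [← mul_assoc, ← mul_pow]; congr 2; field_simp
      _ ≤ (4 / r) ^ n * ((Real.exp (r / (4 * s)) * n.factorial) * Real.exp (-r / (4 * s))) := by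
          gcongr
      _ = (4 / r) ^ n * (n.factorial * (Real.exp (r / (4 * s)) * Real.exp (-r / (4 * s)))) := by
          ring
      _ = _ := by
          rw [← Real.exp_add, neg_div, add_neg_cancel, Real.exp_zero]; ring
  · refine Integrable.mono' (g := fun s => r * s ^ (-2 : ℝ))
      ((integrableOn_Ioi_rpow_of_lt (by norm_num) one_pos).const_mul r)
      (measurable_heatProf n r).aestronglyMeasurable ?_
    exact (ae_restrict_mem measurableSet_Ioi).mono fun s hs => abs_heatProf_le hn hr.le hs

lemma integral_heatProf {n : ℕ} (hn : 2 ≤ n) {r : ℝ} (hr : 0 < r) :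
    ∫ s in Set.Ioi 0, heatProf n r s = r ^ (1 - (n : ℝ) / 2) *
      ((∫ s in Set.Ioi 0, heatProf n 1 s) +
        (4 * π) ^ (-(n : ℝ) / 2) * ∫ s in (1 : ℝ)..r⁻¹, s ^ (-(n : ℝ) / 2)) := by
  have h0 := integral_comp_mul_left_Ioi' (heatProf n r) 0 hr
  rw [mul_zero] at h0
  have hI : ∀ a b : ℝ, 0 < a → IntegrableOn
      (Set.indicator (Set.Ioc a b) fun s : ℝ => (4 * π) ^ (-(n : ℝ) / 2) * s ^ (-(n : ℝ) / 2))
      (Set.Ioi 0) := by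
    intro a b ha
    refine Integrable.integrableOn ((integrable_indicator_iff measurableSet_Ioc).2 ?_)
    refine (ContinuousOn.integrableOn_Icc ?_).mono_set Set.Ioc_subset_Icc_self
    refine continuousOn_const.mul (continuousOn_id.rpow_const fun x hx => Or.inl ?_)
    exact (ha.trans_le hx.1).ne'
  have hE : ∀ a b : ℝ, 0 < a → ∫ s in Set.Ioi 0,
      (Set.indicator (Set.Ioc a b) (fun s : ℝ => (4 * π) ^ (-(n : ℝ) / 2) * s ^ (-(n : ℝ) / 2))) s
      = (4 * π) ^ (-(n : ℝ) / 2) * ∫ s in Set.Ioc a b, s ^ (-(n : ℝ) / 2) := by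
    intro a b ha
    rw [setIntegral_indicator measurableSet_Ioc, Set.inter_eq_right.2, integral_const_mul]
    exact fun x hx => ha.trans hx.1
  have hr' : 0 < r⁻¹ := by positivity
  have h1 : ∫ s in Set.Ioi 0, heatProf n r (r * s) = ∫ s in Set.Ioi 0,
      r ^ (-(n : ℝ) / 2) * (heatProf n 1 s +
      (Set.indicator (Set.Ioc 1 r⁻¹)
        (fun s : ℝ => (4 * π) ^ (-(n : ℝ) / 2) * s ^ (-(n : ℝ) / 2)) s -
      Set.indicator (Set.Ioc r⁻¹ 1)
        (fun s : ℝ => (4 * π) ^ (-(n : ℝ) / 2) * s ^ (-(n : ℝ) / 2)) s)) := by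
    refine setIntegral_congr_fun measurableSet_Ioi fun s hs => ?_
    have hs : 0 < s := hs
    have e1 : (4 * π * (r * s)) ^ (-(n : ℝ) / 2) =
        r ^ (-(n : ℝ) / 2) * ((4 * π) ^ (-(n : ℝ) / 2) * s ^ (-(n : ℝ) / 2)) := by
      rw [← Real.mul_rpow (by positivity) (by positivity),
        ← Real.mul_rpow (by positivity) (by positivity)]
      congr 1; ring
    have e2 : (4 * π * s) ^ (-(n : ℝ) / 2) = (4 * π) ^ (-(n : ℝ) / 2) * s ^ (-(n : ℝ) / 2) :=
      Real.mul_rpow (by positivity) (by positivity)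
    have e3 : -r / (4 * (r * s)) = -1 / (4 * s) := by field_simp
    have e4 : 1 < r * s ↔ r⁻¹ < s := by rw [inv_lt_iff_one_lt_mul₀' hr]
    simp only [heatProf, heatCut, Set.indicator, Set.mem_Ioc, e1, e2, e3, e4]
    split_ifs <;> first | ring1 | (exfalso; grind)
  have hsub : IntegrableOn (fun s : ℝ => Set.indicator (Set.Ioc 1 r⁻¹)
        (fun s : ℝ => (4 * π) ^ (-(n : ℝ) / 2) * s ^ (-(n : ℝ) / 2)) s -
      Set.indicator (Set.Ioc r⁻¹ 1)
        (fun s : ℝ => (4 * π) ^ (-(n : ℝ) / 2) * s ^ (-(n : ℝ) / 2)) s) (Set.Ioi 0) :=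
    (hI _ _ one_pos).sub (hI _ _ hr')
  rw [h1, integral_const_mul, integral_add (integrableOn_heatProf hn one_pos) hsub,
    integral_sub (hI _ _ one_pos) (hI _ _ hr'),
    hE _ _ one_pos, hE _ _ hr'] at h0
  rw [← h0, intervalIntegral, smul_eq_mul, show 1 - (n : ℝ) / 2 = 1 + -n / 2 by ring,
    Real.rpow_add hr, Real.rpow_one]
  ring

lemma integral_heatProf_two_lt {n : ℕ} (hn : 2 ≤ n) :
    ∫ s in Set.Ioi 0, heatProf n 2 s < ∫ s in Set.Ioi 0, heatProf n 1 s := by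
  rw [← sub_pos, ← integral_sub (integrableOn_heatProf hn one_pos)
    (integrableOn_heatProf hn two_pos)]
  have hpos : ∀ s : ℝ, 0 < s → 0 < heatProf n 1 s - heatProf n 2 s := by
    intro s hs
    unfold heatProf
    have : Real.exp (-2 / (4 * s)) < Real.exp (-1 / (4 * s)) := by
      apply Real.exp_lt_exp.2
      gcongr
      norm_num
    have h2 : 0 < (4 * π * s) ^ (-(n : ℝ) / 2) := by positivity
    nlinarith
  rw [integral_pos_iff_support_of_nonneg_ae]
  · have : (Set.Ioi (0 : ℝ)) ⊆
        Function.support (fun s => heatProf n 1 s - heatProf n 2 s) :=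
      fun s hs => (hpos s hs).ne'
    rw [Measure.restrict_apply' measurableSet_Ioi, Set.inter_eq_right.2 this]
    simp
  · exact (ae_restrict_mem measurableSet_Ioi).mono fun s hs => (hpos s hs).le
  · exact (integrableOn_heatProf hn one_pos).sub (integrableOn_heatProf hn two_pos)

lemma lapFund_eq_integral {n : ℕ} (hn : 2 ≤ n) : ∃ A B : ℝ, ∀ y : Euc n, y ≠ 0 →
    lapFund n y = A * (∫ s in Set.Ioi 0, (heatKer n y s - heatCut n s)) + B := by
  simp_rw [← heatProf_norm_sq]
  have h4 : (4 * π) ^ (-(n : ℝ) / 2) ≠ 0 := by positivity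
  rcases hn.eq_or_lt with rfl | hn3
  · set J := ∫ s in Set.Ioi 0, heatProf 2 1 s with hJ
    refine ⟨-(4 * π)⁻¹ * ((4 * π) ^ (-((2 : ℕ) : ℝ) / 2))⁻¹,
      (4 * π)⁻¹ * ((4 * π) ^ (-((2 : ℕ) : ℝ) / 2))⁻¹ * J, fun y hy => ?_⟩
    have hy' : 0 < ‖y‖ := norm_pos_iff.2 hy
    have h1 : ∫ s in (1 : ℝ)..(‖y‖ ^ 2)⁻¹, s ^ (-((2 : ℕ) : ℝ) / 2) = - (2 * Real.log ‖y‖) := by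
      rw [show (-((2 : ℕ) : ℝ) / 2) = -1 by norm_num]
      simp_rw [Real.rpow_neg_one]
      rw [integral_inv_of_pos one_pos (by positivity), div_one, Real.log_inv, Real.log_pow]
      norm_num
    rw [integral_heatProf le_rfl (by positivity), h1, ← hJ, lapFund, if_pos rfl,
      show (1 - ((2 : ℕ) : ℝ) / 2) = 0 by norm_num, Real.rpow_zero]
    field_simp
    ring
  · have hn3' : (3 : ℝ) ≤ n := by exact_mod_cast hn3
    set J := ∫ s in Set.Ioi 0, heatProf n 1 s with hJ
    set κ := (4 * π) ^ (-(n : ℝ) / 2) / (1 - n / 2) with hκ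
    have ha : 1 - (n : ℝ) / 2 ≠ 0 := by linarith
    have hform : ∀ r : ℝ, 0 < r → ∫ s in Set.Ioi 0, heatProf n r s =
        r ^ (1 - (n : ℝ) / 2) * (J - κ) + κ := by
      intro r hr
      have hr2 : r ^ (1 - (n : ℝ) / 2) ≠ 0 := by positivity
      rw [integral_heatProf hn hr, integral_rpow, show -(n : ℝ) / 2 + 1 = 1 - n / 2 by ring,
        Real.one_rpow, ← hJ, hκ, Real.inv_rpow hr.le]
      · field_simp
        ring
      · refine Or.inr ⟨by linarith, fun h => ?_⟩
        rw [Set.mem_uIcc] at h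
        have : 0 < r⁻¹ := by positivity
        rcases h with h | h <;> linarith [h.1, h.2]
    have hne : J - κ ≠ 0 := by
      intro h
      have := integral_heatProf_two_lt hn
      rw [hform 2 two_pos, hform 1 one_pos, h] at this
      simp at this
    obtain ⟨c, hc⟩ : ∃ c, c =
        -((((n : ℝ) - 2) * (2 * π ^ ((n : ℝ) / 2) / Real.Gamma ((n : ℝ) / 2)))⁻¹) := ⟨_, rfl⟩
    refine ⟨c / (J - κ), -(c / (J - κ)) * κ, fun y hy => ?_⟩
    have hy' : 0 < ‖y‖ := norm_pos_iff.2 hy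
    rw [hform _ (by positivity), lapFund, if_neg (by omega), ← hc, ← Real.rpow_natCast,
      ← Real.rpow_mul hy'.le, show ((2 : ℕ) : ℝ) * (1 - n / 2) = 2 - n by push_cast; ring]
    field_simp
    ring

lemma integrable_heatProf_mul_heatKer {n : ℕ} (hn : 2 ≤ n) (x : Euc n) {t : ℝ} (ht : 0 < t) :
    Integrable (fun z : Euc n × ℝ => (heatKer n z.1 z.2 - heatCut n z.2) * heatKer n (x - z.1) t)
      (volume.prod (volume.restrict (Set.Ioi 0))) := by
  have hmeas : Measurable (fun z : Euc n × ℝ =>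
      (heatKer n z.1 z.2 - heatCut n z.2) * heatKer n (x - z.1) t) :=
    ((measurable_heatKer n).sub ((measurable_heatCut n).comp measurable_snd)).mul
      ((measurable_heatKer n).comp (by fun_prop : Measurable fun z : Euc n × ℝ => (x - z.1, t)))
  have hint : ∀ s : ℝ, 0 < s → Integrable (fun y : Euc n =>
      (heatKer n y s - heatCut n s) * heatKer n (x - y) t) := by
    intro s hs
    simp_rw [sub_mul]
    exact (integrable_heatKer_mul n x hs ht).sub ((integrable_heatKer_sub n x ht).const_mul _)
  rw [integrable_prod_iff' hmeas.aestronglyMeasurable]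
  refine ⟨(ae_restrict_mem measurableSet_Ioi).mono fun s hs => hint s hs, ?_⟩
  have hm : AEStronglyMeasurable (fun s : ℝ => ∫ y : Euc n,
      ‖(heatKer n y s - heatCut n s) * heatKer n (x - y) t‖) volume :=
    (hmeas.norm.stronglyMeasurable.integral_prod_left' (μ := volume)).aestronglyMeasurable
  change IntegrableOn _ _ _
  rw [← Set.Ioc_union_Ioi_eq_Ioi zero_le_one]
  refine IntegrableOn.union ?_ ?_
  · refine Integrable.mono' (g := fun _ => (4 * π * t) ^ (-(n : ℝ) / 2))
      (integrableOn_const (by simp)) hm.restrict ?_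
    refine (ae_restrict_mem measurableSet_Ioc).mono fun s hs => ?_
    have hs0 : 0 < s := hs.1
    have e : ∀ y : Euc n, ‖(heatKer n y s - heatCut n s) * heatKer n (x - y) t‖ =
        heatKer n y s * heatKer n (x - y) t := by
      intro y
      rw [heatCut, if_neg (not_lt.2 hs.2), sub_zero, Real.norm_of_nonneg]
      exact mul_nonneg (heatKer_nonneg n y hs0) (heatKer_nonneg n _ ht)
    simp_rw [e]
    rw [integral_heatKer_mul n x hs0 ht,
      Real.norm_of_nonneg (heatKer_nonneg n x (by positivity))]
    unfold heatKer
    have h1 : (4 * π * (s + t)) ^ (-(n : ℝ) / 2) ≤ (4 * π * t) ^ (-(n : ℝ) / 2) := by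
      refine Real.rpow_le_rpow_of_nonpos (by positivity) (by gcongr; linarith) ?_
      have : (0 : ℝ) ≤ n := by positivity
      linarith
    have h2 : Real.exp (-‖x‖ ^ 2 / (4 * (s + t))) ≤ 1 :=
      Real.exp_le_one_iff.2 (div_nonpos_of_nonpos_of_nonneg (by simp) (by positivity))
    calc _ ≤ (4 * π * t) ^ (-(n : ℝ) / 2) * 1 := by gcongr
      _ = _ := mul_one _
  · refine Integrable.mono' (g := fun s => (∫ y : Euc n, ‖y‖ ^ 2 * heatKer n (x - y) t) *
      s ^ (-2 : ℝ)) ((integrableOn_Ioi_rpow_of_lt (by norm_num) one_pos).const_mul _)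
      hm.restrict ?_
    refine (ae_restrict_mem measurableSet_Ioi).mono fun s hs => ?_
    have hs : 1 < s := hs
    rw [Real.norm_of_nonneg (integral_nonneg fun _ => norm_nonneg _), ← integral_mul_const]
    refine integral_mono (hint s (by linarith)).norm
      ((integrable_sq_norm_mul_heatKer n x ht).mul_const _) fun y => ?_
    change ‖(heatKer n y s - heatCut n s) * heatKer n (x - y) t‖ ≤ _
    rw [norm_mul, Real.norm_of_nonneg (heatKer_nonneg n _ ht), ← heatProf_norm_sq]
    have := abs_heatProf_le hn (sq_nonneg ‖y‖) hs
    rw [Real.norm_eq_abs]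
    have h0 := heatKer_nonneg n (x - y) ht
    nlinarith

lemma integral_heatProf_mul_heatKer {n : ℕ} (x : Euc n) {s t : ℝ} (hs : 0 < s) (ht : 0 < t) :
    ∫ y : Euc n, (heatKer n y s - heatCut n s) * heatKer n (x - y) t =
      heatKer n x (s + t) - heatCut n s := by
  simp_rw [sub_mul]
  rw [integral_sub (integrable_heatKer_mul n x hs ht) ((integrable_heatKer_sub n x ht).const_mul _),
    integral_heatKer_mul n x hs ht, integral_const_mul, integral_heatKer_sub n x ht, mul_one]

lemma integrableOn_heatKer_shift {n : ℕ} (hn : 2 ≤ n) (x : Euc n) {t : ℝ} (ht : 0 < t) :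
    IntegrableOn (fun s => heatKer n x (s + t) - heatCut n s) (Set.Ioi 0) := by
  refine (integrable_heatProf_mul_heatKer hn x ht).integral_prod_right.congr ?_
  exact (ae_restrict_mem measurableSet_Ioi).mono fun s hs => integral_heatProf_mul_heatKer x hs ht

lemma genPhi_eq_integral {n : ℕ} (hn : 2 ≤ n) : ∃ A B : ℝ, ∀ (x : Euc n) (t : ℝ), 0 < t →
    genPhi n x t = A * (∫ s in Set.Ioi 0, (heatKer n x (s + t) - heatCut n s)) + B := by
  obtain ⟨A, B, h⟩ := lapFund_eq_integral hn
  refine ⟨A, B, fun x t ht => ?_⟩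
  have hint := integrable_heatProf_mul_heatKer hn x ht
  have h1 : genPhi n x t = ∫ y : Euc n, (A * (∫ s in Set.Ioi 0,
      (heatKer n y s - heatCut n s) * heatKer n (x - y) t) + B * heatKer n (x - y) t) := by
    have : Nonempty (Fin n) := ⟨⟨0, by omega⟩⟩
    have : Nontrivial (Euc n) := inferInstance
    refine integral_congr_ae ?_
    have : ∀ᵐ y : Euc n, y ≠ 0 := by
      simp [ae_iff]
    filter_upwards [this] with y hy
    rw [h y hy, integral_mul_const]
    ring
  rw [h1, integral_add (hint.integral_prod_left.const_mul A)
    ((integrable_heatKer_sub n x ht).const_mul B), integral_const_mul, integral_const_mul,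
    integral_heatKer_sub n x ht, mul_one, integral_integral_swap hint]
  congr 2
  exact setIntegral_congr_fun measurableSet_Ioi fun s hs => integral_heatProf_mul_heatKer x hs ht

/-- The `k`-th derivative of the heat kernel at time `σ` in the variable `r = |x|²`, up to sign. -/
def heatDer (n k : ℕ) (r σ : ℝ) : ℝ :=
  (4 * π * σ) ^ (-(n : ℝ) / 2) * ((4 * σ)⁻¹) ^ k * Real.exp (-r / (4 * σ))

/-- The integral of `heatDer` over all times larger than `t`. -/
def heatDerInt (n k : ℕ) (t r : ℝ) : ℝ := ∫ s in Set.Ioi 0, heatDer n k r (s + t)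

lemma measurable_heatDer (n k : ℕ) (r t : ℝ) : Measurable fun s => heatDer n k r (s + t) := by
  unfold heatDer; fun_prop

lemma heatDer_nonneg (n k : ℕ) (r : ℝ) {σ : ℝ} (hσ : 0 < σ) : 0 ≤ heatDer n k r σ := by
  unfold heatDer; positivity

lemma heatDer_coeff_le (n k : ℕ) {σ : ℝ} (hσ : 0 < σ) :
    (4 * π * σ) ^ (-(n : ℝ) / 2) * ((4 * σ)⁻¹) ^ k ≤ σ ^ (-(n : ℝ) / 2 - k) := by
  have e : σ ^ (-(n : ℝ) / 2 - k) = σ ^ (-(n : ℝ) / 2) * (σ⁻¹) ^ k := by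
    rw [Real.rpow_sub hσ, Real.rpow_natCast, inv_pow]
    exact div_eq_mul_inv _ _
  rw [e]
  have h1 : (4 * π * σ) ^ (-(n : ℝ) / 2) ≤ σ ^ (-(n : ℝ) / 2) := by
    refine Real.rpow_le_rpow_of_nonpos hσ (by nlinarith [Real.pi_gt_three]) ?_
    have : (0 : ℝ) ≤ n := by positivity
    linarith
  have h2 : (4 * σ)⁻¹ ≤ σ⁻¹ := inv_anti₀ hσ (by linarith)
  gcongr

lemma integrableOn_add_rpow_Ioi_zero {a t : ℝ} (ha : a < -1) (ht : 0 < t) :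
    IntegrableOn (fun s : ℝ => (s + t) ^ a) (Set.Ioi 0) :=
  integrableOn_add_rpow_Ioi_of_lt ha (by linarith)

lemma heatDer_le {n k : ℕ} {r t s : ℝ} (hr : -1 ≤ r) (ht : 0 < t) (hs : 0 < s) :
    heatDer n k r (s + t) ≤ Real.exp (1 / (4 * t)) * (s + t) ^ (-(n : ℝ) / 2 - k) := by
  unfold heatDer
  rw [mul_comm]
  have hst : 0 < s + t := by linarith
  have h1 : -r / (4 * (s + t)) ≤ 1 / (4 * t) :=
    calc -r / (4 * (s + t)) ≤ 1 / (4 * (s + t)) := by gcongr; linarith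
      _ ≤ _ := by gcongr; linarith
  have := heatDer_coeff_le n k hst
  gcongr

lemma integrableOn_heatDer {n k : ℕ} (hn : 2 ≤ n) (hk : 1 ≤ k) {r t : ℝ} (hr : -1 ≤ r)
    (ht : 0 < t) : IntegrableOn (fun s => heatDer n k r (s + t)) (Set.Ioi 0) := by
  have hn' : (2 : ℝ) ≤ n := by exact_mod_cast hn
  have hk' : (1 : ℝ) ≤ k := by exact_mod_cast hk
  refine Integrable.mono' (g := fun s =>
      Real.exp (1 / (4 * t)) * (s + t) ^ (-(n : ℝ) / 2 - k))
    ((integrableOn_add_rpow_Ioi_zero (by linarith) ht).const_mul _)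
    (measurable_heatDer n k r t).aestronglyMeasurable ?_
  refine (ae_restrict_mem measurableSet_Ioi).mono fun s hs => ?_
  have hs : 0 < s := hs
  rw [Real.norm_of_nonneg (heatDer_nonneg n k r (by linarith))]
  exact heatDer_le hr ht hs

lemma hasDerivAt_integral_heatDer_sub {n k : ℕ} (hn : 2 ≤ n) {r t : ℝ} (hr : 0 ≤ r) (ht : 0 < t)
    {d : ℝ → ℝ} (hd : Measurable d)
    (hint : IntegrableOn (fun s => heatDer n k r (s + t) - d s) (Set.Ioi 0)) :
    HasDerivAt (fun r => ∫ s in Set.Ioi 0, (heatDer n k r (s + t) - d s))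
      (-heatDerInt n (k + 1) t r) r := by
  have hn' : (2 : ℝ) ≤ n := by exact_mod_cast hn
  have hk' : (0 : ℝ) ≤ k := by positivity
  have h := hasDerivAt_integral_of_dominated_loc_of_deriv_le (μ := volume.restrict (Set.Ioi 0))
    (F := fun r s => heatDer n k r (s + t) - d s)
    (F' := fun r s => -heatDer n (k + 1) r (s + t)) (x₀ := r)
    (s := Metric.ball r 1)
    (bound := fun s => Real.exp (1 / (4 * t)) * (s + t) ^ (-(n : ℝ) / 2 - (k + 1 : ℕ)))
    (Metric.ball_mem_nhds r one_pos)
    (Eventually.of_forall fun r => ((measurable_heatDer n k r t).sub hd).aestronglyMeasurable)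
    hint (measurable_heatDer n (k + 1) r t).neg.aestronglyMeasurable ?_
    ((integrableOn_add_rpow_Ioi_zero (by push_cast; linarith) ht).const_mul _) ?_
  · rw [heatDerInt, ← integral_neg]
    exact h.2
  · refine (ae_restrict_mem measurableSet_Ioi).mono fun s hs r' hr' => ?_
    have hs : 0 < s := hs
    rw [norm_neg, Real.norm_of_nonneg (heatDer_nonneg _ _ _ (by linarith))]
    refine heatDer_le ?_ ht hs
    rw [Metric.mem_ball, Real.dist_eq] at hr'
    linarith [(abs_lt.1 hr').1]
  · refine (ae_restrict_mem measurableSet_Ioi).mono fun s hs r' hr' => ?_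
    have hs : 0 < s := hs
    have h1 : HasDerivAt (fun r : ℝ => -r / (4 * (s + t))) (-1 / (4 * (s + t))) r' :=
      ((hasDerivAt_id r').neg).div_const _
    have h2 := ((h1.exp.const_mul ((4 * π * (s + t)) ^ (-(n : ℝ) / 2) *
      ((4 * (s + t))⁻¹) ^ k)).sub_const (d s))
    refine h2.congr_deriv ?_
    unfold heatDer
    rw [pow_succ]
    ring

lemma hasDerivAt_heatDerInt {n k : ℕ} (hn : 2 ≤ n) (hk : 1 ≤ k) {r t : ℝ} (hr : 0 ≤ r)
    (ht : 0 < t) : HasDerivAt (heatDerInt n k t) (-heatDerInt n (k + 1) t r) r := by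
  have h := hasDerivAt_integral_heatDer_sub (k := k) hn hr ht (d := fun _ => 0) measurable_const
    (by simpa using integrableOn_heatDer hn hk (by linarith) ht)
  simp only [sub_zero] at h
  exact h

lemma pd_eq_of_hasFDerivAt {n : ℕ} {f : Euc n → ℝ} {f' : Euc n →L[ℝ] ℝ} {x : Euc n}
    (h : HasFDerivAt f f' x) (i : Fin n) : pd n i f x = f' (EuclideanSpace.single i 1) := by
  rw [pd, h.fderiv]

lemma hasFDerivAt_comp_norm_sq {n : ℕ} {ψ : ℝ → ℝ} {ψ' : ℝ} {x : Euc n}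
    (h : HasDerivAt ψ ψ' (‖x‖ ^ 2)) :
    HasFDerivAt (fun y : Euc n => ψ (‖y‖ ^ 2)) (ψ' • (2 • innerSL ℝ x)) x :=
  h.comp_hasFDerivAt x (hasStrictFDerivAt_norm_sq x).hasFDerivAt

lemma pd_comp_norm_sq {n : ℕ} {ψ : ℝ → ℝ} {ψ' : ℝ} {x : Euc n}
    (h : HasDerivAt ψ ψ' (‖x‖ ^ 2)) (i : Fin n) :
    pd n i (fun y : Euc n => ψ (‖y‖ ^ 2)) x = 2 * x i * ψ' := by
  rw [pd_eq_of_hasFDerivAt (hasFDerivAt_comp_norm_sq h)]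
  simp [EuclideanSpace.inner_single_right]
  ring

lemma pd_coord {n : ℕ} (i k : Fin n) (x : Euc n) :
    pd n k (fun y : Euc n => y i) x = if i = k then 1 else 0 := by
  have h : HasFDerivAt (fun y : Euc n => y i) (EuclideanSpace.proj i : Euc n →L[ℝ] ℝ) x :=
    (EuclideanSpace.proj i : Euc n →L[ℝ] ℝ).hasFDerivAt
  rw [pd_eq_of_hasFDerivAt h]
  simp

lemma pd_add {n : ℕ} {f g : Euc n → ℝ} {x : Euc n} (hf : DifferentiableAt ℝ f x)
    (hg : DifferentiableAt ℝ g x) (i : Fin n) :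
    pd n i (fun y => f y + g y) x = pd n i f x + pd n i g x := by
  rw [pd_eq_of_hasFDerivAt (hf.hasFDerivAt.fun_add hg.hasFDerivAt)]
  simp [pd]

lemma pd_mul {n : ℕ} {f g : Euc n → ℝ} {x : Euc n} (hf : DifferentiableAt ℝ f x)
    (hg : DifferentiableAt ℝ g x) (i : Fin n) :
    pd n i (fun y => f y * g y) x = f x * pd n i g x + g x * pd n i f x := by
  rw [pd_eq_of_hasFDerivAt (hf.hasFDerivAt.fun_mul hg.hasFDerivAt)]
  simp [pd]

lemma pd_const_mul {n : ℕ} {f : Euc n → ℝ} {x : Euc n} (c : ℝ) (hf : DifferentiableAt ℝ f x)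
    (i : Fin n) : pd n i (fun y => c * f y) x = c * pd n i f x := by
  rw [pd_eq_of_hasFDerivAt (hf.hasFDerivAt.const_mul c)]
  simp [pd]

lemma pd_sum {n : ℕ} {ι : Type*} (s : Finset ι) {f : ι → Euc n → ℝ} {x : Euc n}
    (hf : ∀ l ∈ s, DifferentiableAt ℝ (f l) x) (i : Fin n) :
    pd n i (fun y => ∑ l ∈ s, f l y) x = ∑ l ∈ s, pd n i (f l) x := by
  rw [pd_eq_of_hasFDerivAt (HasFDerivAt.fun_sum fun l hl => (hf l hl).hasFDerivAt)]
  simp [pd]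

lemma differentiable_heatDerInt_norm_sq {n k : ℕ} (hn : 2 ≤ n) (hk : 1 ≤ k) {t : ℝ}
    (ht : 0 < t) : Differentiable ℝ fun y : Euc n => heatDerInt n k t (‖y‖ ^ 2) := fun x =>
  (hasFDerivAt_comp_norm_sq (hasDerivAt_heatDerInt hn hk (sq_nonneg ‖x‖) ht)).differentiableAt

lemma differentiable_coord {n : ℕ} (i : Fin n) : Differentiable ℝ fun y : Euc n => y i :=
  (EuclideanSpace.proj i : Euc n →L[ℝ] ℝ).differentiable

lemma pd_heatDerInt_norm_sq {n k : ℕ} (hn : 2 ≤ n) (hk : 1 ≤ k) {t : ℝ}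
    (ht : 0 < t) (i : Fin n) (x : Euc n) :
    pd n i (fun y : Euc n => heatDerInt n k t (‖y‖ ^ 2)) x =
      -2 * x i * heatDerInt n (k + 1) t (‖x‖ ^ 2) := by
  rw [pd_comp_norm_sq (hasDerivAt_heatDerInt hn hk (sq_nonneg ‖x‖) ht)]
  ring

lemma pd_genPhi {n : ℕ} (hn : 2 ≤ n) : ∃ A : ℝ, ∀ t : ℝ, 0 < t → ∀ (j : Fin n) (x : Euc n),
    pd n j (fun y => genPhi n y t) x = A * (x j * heatDerInt n 1 t (‖x‖ ^ 2)) := by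
  obtain ⟨A, B, h⟩ := genPhi_eq_integral hn
  refine ⟨-2 * A, fun t ht j x => ?_⟩
  have h1 : (fun y => genPhi n y t) = fun y => (fun r : ℝ => A * (∫ s in Set.Ioi 0,
      (heatDer n 0 r (s + t) - heatCut n s)) + B) (‖y‖ ^ 2) := by
    funext y
    simp [h y t ht, heatDer, heatKer]
  have h2 := hasDerivAt_integral_heatDer_sub (n := n) (k := 0) hn (sq_nonneg ‖x‖) ht
    (measurable_heatCut n)
    (by simpa [heatDer, heatKer] using integrableOn_heatKer_shift hn x ht)
  rw [h1, pd_comp_norm_sq ((h2.const_mul A).add_const B)]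
  ring

lemma pd_pd_genPhi {n : ℕ} (hn : 2 ≤ n) : ∃ A : ℝ, ∀ t : ℝ, 0 < t → ∀ i j : Fin n,
    pd n i (pd n j (fun y => genPhi n y t)) = fun x => A * ((if j = i then 1 else 0) *
      heatDerInt n 1 t (‖x‖ ^ 2) + -2 * ((x i * x j) * heatDerInt n 2 t (‖x‖ ^ 2))) := by
  obtain ⟨A, h⟩ := pd_genPhi hn
  refine ⟨A, fun t ht i j => ?_⟩
  funext x
  have h1 : pd n j (fun y => genPhi n y t) = fun x =>
      A * (x j * heatDerInt n 1 t (‖x‖ ^ 2)) := funext (h t ht j)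
  have d1 := differentiable_heatDerInt_norm_sq (n := n) hn le_rfl ht x
  have d2 := differentiable_coord j x
  rw [h1, pd_const_mul _ (d2.fun_mul d1), pd_mul d2 d1, pd_heatDerInt_norm_sq hn le_rfl ht,
    pd_coord]
  ring

lemma abs_coord_le {n : ℕ} (x : Euc n) (i : Fin n) : |x i| ≤ ‖x‖ := by
  simpa using PiLp.norm_apply_le x i

lemma abs_Kten_le_heatDerInt {n : ℕ} (hn : 2 ≤ n) : ∃ C : ℝ, 0 ≤ C ∧
    ∀ (i j k : Fin n) (x : Euc n) (t : ℝ), 0 < t → |Kten n i j k x t| ≤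
      C * (‖x‖ * heatDerInt n 2 t (‖x‖ ^ 2) + ‖x‖ ^ 3 * heatDerInt n 3 t (‖x‖ ^ 2)) := by
  obtain ⟨A, h⟩ := pd_pd_genPhi hn
  refine ⟨(n + 1) * (|A| * 6), by positivity, fun i j k x t ht => ?_⟩
  set P2 := heatDerInt n 2 t (‖x‖ ^ 2) with hP2
  set P3 := heatDerInt n 3 t (‖x‖ ^ 2) with hP3
  have hnn : ∀ m, 0 ≤ heatDerInt n m t (‖x‖ ^ 2) := fun m =>
    setIntegral_nonneg measurableSet_Ioi fun s hs =>
      heatDer_nonneg _ _ _ (by have hs : 0 < s := hs; linarith)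
  have hP2n : 0 ≤ P2 := hnn 2
  have hP3n : 0 ≤ P3 := hnn 3
  have d1 := differentiable_heatDerInt_norm_sq (n := n) hn le_rfl ht
  have d2 := differentiable_heatDerInt_norm_sq (n := n) (k := 2) hn (by norm_num) ht
  have dc := fun l : Fin n => differentiable_coord l
  have hdiff : ∀ i j : Fin n,
      DifferentiableAt ℝ (pd n i (pd n j (fun y => genPhi n y t))) x := by
    intro i j
    rw [h t ht i j]
    exact (((d1 x).const_mul _).fun_add
      ((((dc i x).fun_mul (dc j x)).fun_mul (d2 x)).const_mul _)).const_mul _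
  have hT : ∀ i j : Fin n, |pd n k (pd n i (pd n j (fun y => genPhi n y t))) x| ≤
      |A| * 6 * (‖x‖ * P2 + ‖x‖ ^ 3 * P3) := by
    intro i j
    rw [h t ht i j, pd_const_mul, pd_add, pd_const_mul, pd_const_mul, pd_mul, pd_mul,
      pd_heatDerInt_norm_sq hn le_rfl ht, pd_heatDerInt_norm_sq hn (by norm_num) ht,
      pd_coord, pd_coord, abs_mul, mul_assoc |A| 6, ← hP2, ← hP3]
    · refine mul_le_mul_of_nonneg_left ?_ (abs_nonneg A)
      have hi := abs_coord_le x i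
      have hj := abs_coord_le x j
      have hk := abs_coord_le x k
      have hx := norm_nonneg x
      have t1 : |(if j = i then (1 : ℝ) else 0) * (-2 * x k * P2)| ≤ 2 * (‖x‖ * P2) := by
        rw [abs_mul, abs_mul, abs_mul, abs_of_nonneg hP2n]
        split_ifs
        · norm_num; nlinarith
        · norm_num; positivity
      have t2 : |-2 * (x i * x j * (-2 * x k * P3))| ≤ 4 * (‖x‖ ^ 3 * P3) := by
        rw [show -2 * (x i * x j * (-2 * x k * P3)) = 4 * ((x i * x j * x k) * P3) by ring,
          abs_mul, abs_mul, abs_of_nonneg hP3n, abs_mul, abs_mul]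
        norm_num
        gcongr
        calc |x i| * |x j| * |x k| ≤ ‖x‖ * ‖x‖ * ‖x‖ := by gcongr
          _ = _ := by ring
      have t3 : |-2 * (P2 * (x i * if j = k then (1 : ℝ) else 0))| ≤ 2 * (‖x‖ * P2) := by
        rw [abs_mul, abs_mul, abs_mul, abs_of_nonneg hP2n]
        split_ifs
        · norm_num; nlinarith
        · norm_num; positivity
      have t4 : |-2 * (P2 * (x j * if i = k then (1 : ℝ) else 0))| ≤ 2 * (‖x‖ * P2) := by
        rw [abs_mul, abs_mul, abs_mul, abs_of_nonneg hP2n]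
        split_ifs
        · norm_num; nlinarith
        · norm_num; positivity
      have key : ∀ a b c d e : ℝ, e = a + b + c + d → |e| ≤ |a| + |b| + |c| + |d| := by
        rintro a b c d e rfl
        linarith [abs_add_le (a + b + c) d, abs_add_le (a + b) c, abs_add_le a b]
      refine (key _ _ _ _ _ ?_).trans (?_ :
        |(if j = i then (1 : ℝ) else 0) * (-2 * x k * P2)| + |-2 * (x i * x j * (-2 * x k * P3))| +
        |-2 * (P2 * (x i * if j = k then (1 : ℝ) else 0))| +
        |-2 * (P2 * (x j * if i = k then (1 : ℝ) else 0))| ≤ _)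
      · ring
      · have : 0 ≤ ‖x‖ ^ 3 * P3 := by positivity
        linarith
    · exact dc i x
    · exact dc j x
    · exact (dc i x).fun_mul (dc j x)
    · exact d2 x
    · exact ((dc i x).fun_mul (dc j x)).fun_mul (d2 x)
    · exact d1 x
    · exact (d1 x).const_mul _
    · exact (((dc i x).fun_mul (dc j x)).fun_mul (d2 x)).const_mul _
    · exact ((d1 x).const_mul _).fun_add ((((dc i x).fun_mul (dc j x)).fun_mul (d2 x)).const_mul _)
  set S := |A| * 6 * (‖x‖ * P2 + ‖x‖ ^ 3 * P3) with hS
  have hS0 : 0 ≤ S := by positivity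
  have hlap : |pd n k (fun y => lap n (fun y => genPhi n y t) y) x| ≤ n * S := by
    unfold lap
    rw [pd_sum _ fun l _ => hdiff l l]
    refine (Finset.abs_sum_le_sum_abs _ _).trans ?_
    refine (Finset.sum_le_sum fun l _ => hT l l).trans ?_
    simp
  have hgoal : (n + 1) * (|A| * 6) * (‖x‖ * P2 + ‖x‖ ^ 3 * P3) = n * S + S := by rw [hS]; ring
  rw [hgoal]
  unfold Kten Kmat
  by_cases hij : i = j
  · simp only [hij, if_true]
    have hld : DifferentiableAt ℝ (fun y => lap n (fun y => genPhi n y t) y) x := by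
      unfold lap
      exact DifferentiableAt.fun_sum fun l _ => hdiff l l
    have e : pd n k (fun y => -lap n (fun y => genPhi n y t) y) x =
        -pd n k (fun y => lap n (fun y => genPhi n y t) y) x := by
      rw [pd_eq_of_hasFDerivAt hld.hasFDerivAt.fun_neg]
      simp [pd]
    rw [pd_add hld.fun_neg (hdiff j j), e]
    refine (abs_add_le _ _).trans (add_le_add ?_ (hT j j))
    rwa [abs_neg]
  · simp only [hij, if_false, zero_add]
    have := hT i j
    have : 0 ≤ n * S := by positivity
    linarith [hT i j]

/-- Spatial Gaussian profile majorising third derivatives of the heat kernel at time `σ`. -/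
def gaussMaj (n : ℕ) (x : Euc n) (σ : ℝ) : ℝ :=
  σ ^ (-((n : ℝ) + 3) / 2) * Real.exp (-‖x‖ ^ 2 / (8 * σ))

lemma measurable_gaussMaj (n : ℕ) : Measurable (fun z : Euc n × ℝ => gaussMaj n z.1 z.2) := by
  unfold gaussMaj; fun_prop

lemma gaussMaj_nonneg (n : ℕ) (x : Euc n) {σ : ℝ} (hσ : 0 < σ) : 0 ≤ gaussMaj n x σ := by
  unfold gaussMaj; positivity

lemma heatDer_le_gaussMaj (n : ℕ) (x : Euc n) {σ : ℝ} (hσ : 0 < σ) :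
    ‖x‖ * heatDer n 2 (‖x‖ ^ 2) σ + ‖x‖ ^ 3 * heatDer n 3 (‖x‖ ^ 2) σ ≤
      137 * gaussMaj n x σ := by
  set u := ‖x‖ / σ ^ (1 / 2 : ℝ) with hu
  have hq : 0 < σ ^ (1 / 2 : ℝ) := by positivity
  have hxu : ‖x‖ = u * σ ^ (1 / 2 : ℝ) := by rw [hu]; field_simp
  have hu0 : 0 ≤ u := by positivity
  have hsq : (σ ^ (1 / 2 : ℝ)) ^ 2 = σ := by
    rw [← Real.rpow_natCast, ← Real.rpow_mul hσ.le]; norm_num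
  have hx2 : ‖x‖ ^ 2 = u ^ 2 * σ := by rw [hxu, mul_pow, hsq]
  set E := Real.exp (-(u ^ 2) / 8) with hE
  have hEE : Real.exp (-‖x‖ ^ 2 / (4 * σ)) = E * E := by
    rw [hE, ← Real.exp_add, hx2]; congr 1; field_simp; ring
  have hE1 : Real.exp (-‖x‖ ^ 2 / (8 * σ)) = E := by
    rw [hE, hx2]; congr 1; field_simp
  have hE0 : 0 < E := Real.exp_pos _
  have hinv : Real.exp (u ^ 2 / 8) * E = 1 := by
    rw [hE, ← Real.exp_add, neg_div, add_neg_cancel, Real.exp_zero]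
  have hb1 : u * E ≤ 8 := by
    have h1 := Real.add_one_le_exp (u ^ 2 / 8)
    have : u ≤ 8 * Real.exp (u ^ 2 / 8) := by nlinarith [sq_nonneg (u - 1)]
    nlinarith
  have hb3 : u ^ 3 * E ≤ 129 := by
    have h1 := Real.pow_div_factorial_le_exp (u ^ 2 / 8) (by positivity) 2
    have h2 := Real.one_le_exp (show 0 ≤ u ^ 2 / 8 by positivity)
    norm_num [Nat.factorial] at h1
    have h3 : u ^ 3 ≤ 1 + u ^ 4 := by
      nlinarith [sq_nonneg (u ^ 2 - u), sq_nonneg (u ^ 2 - 1), sq_nonneg (u - 1), sq_nonneg u]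
    have : u ^ 3 ≤ 129 * Real.exp (u ^ 2 / 8) := by nlinarith
    nlinarith
  have c2 : (4 * π * σ) ^ (-(n : ℝ) / 2) * ((4 * σ)⁻¹) ^ 2 * σ ^ (1 / 2 : ℝ) ≤
      σ ^ (-((n : ℝ) + 3) / 2) := by
    calc _ ≤ σ ^ (-(n : ℝ) / 2 - (2 : ℕ)) * σ ^ (1 / 2 : ℝ) := by
          gcongr; exact heatDer_coeff_le n 2 hσ
      _ = _ := by rw [← Real.rpow_add hσ]; congr 1; push_cast; ring
  have c3 : (4 * π * σ) ^ (-(n : ℝ) / 2) * ((4 * σ)⁻¹) ^ 3 * (σ ^ (1 / 2 : ℝ)) ^ 3 ≤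
      σ ^ (-((n : ℝ) + 3) / 2) := by
    calc _ ≤ σ ^ (-(n : ℝ) / 2 - (3 : ℕ)) * (σ ^ (1 / 2 : ℝ)) ^ 3 := by
          gcongr; exact heatDer_coeff_le n 3 hσ
      _ = _ := by
          rw [← Real.rpow_natCast (σ ^ (1 / 2 : ℝ)), ← Real.rpow_mul hσ.le,
            ← Real.rpow_add hσ]
          congr 1; push_cast; ring
  unfold heatDer gaussMaj
  rw [hEE, hE1]
  set M := σ ^ (-((n : ℝ) + 3) / 2)
  have hM : 0 ≤ M := by positivity
  set c := (4 * π * σ) ^ (-(n : ℝ) / 2)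
  calc _ = (c * ((4 * σ)⁻¹) ^ 2 * σ ^ (1 / 2 : ℝ)) * (u * E) * E +
        (c * ((4 * σ)⁻¹) ^ 3 * (σ ^ (1 / 2 : ℝ)) ^ 3) * (u ^ 3 * E) * E := by
        rw [hxu]; ring
    _ ≤ M * 8 * E + M * 129 * E := by gcongr
    _ = _ := by ring

lemma integrableOn_gaussMaj (n : ℕ) (x : Euc n) {t : ℝ} (ht : 0 < t) :
    IntegrableOn (fun s => gaussMaj n x (s + t)) (Set.Ioi 0) := by
  have hn' : (0 : ℝ) ≤ n := by positivity
  refine Integrable.mono' (g := fun s => (s + t) ^ (-((n : ℝ) + 3) / 2))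
    (integrableOn_add_rpow_Ioi_zero (by linarith) ht)
    ((measurable_gaussMaj n).comp
      (by fun_prop : Measurable fun s : ℝ => (x, s + t))).aestronglyMeasurable ?_
  refine (ae_restrict_mem measurableSet_Ioi).mono fun s hs => ?_
  have hs : 0 < s := hs
  have hst : 0 < s + t := by linarith
  rw [Real.norm_of_nonneg (gaussMaj_nonneg n x hst)]
  unfold gaussMaj
  exact mul_le_of_le_one_right (by positivity)
    (Real.exp_le_one_iff.2 (div_nonpos_of_nonpos_of_nonneg (by simp) (by positivity)))

/-- Majorant of the derivative of the Oseen kernel. -/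
def oseenMaj (n : ℕ) (x : Euc n) (t : ℝ) : ENNReal :=
  ∫⁻ s in Set.Ioi 0, ENNReal.ofReal (gaussMaj n x (s + t))

lemma enorm_Kten_le {n : ℕ} (hn : 2 ≤ n) : ∃ C : ENNReal, C ≠ ⊤ ∧
    ∀ (i j k : Fin n) (x : Euc n) (t : ℝ), 0 < t → ‖Kten n i j k x t‖ₑ ≤ C * oseenMaj n x t := by
  obtain ⟨C, hC, h⟩ := abs_Kten_le_heatDerInt hn
  refine ⟨ENNReal.ofReal (C * 137), ENNReal.ofReal_ne_top, fun i j k x t ht => ?_⟩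
  have hx : (-1 : ℝ) ≤ ‖x‖ ^ 2 := by linarith [sq_nonneg ‖x‖]
  have i2 := (integrableOn_heatDer (k := 2) hn (by norm_num) hx ht).const_mul ‖x‖
  have i3 := (integrableOn_heatDer (k := 3) hn (by norm_num) hx ht).const_mul (‖x‖ ^ 3)
  have h1 : |Kten n i j k x t| ≤ C * 137 * ∫ s in Set.Ioi 0, gaussMaj n x (s + t) := by
    refine (h i j k x t ht).trans ?_
    rw [mul_assoc]
    refine mul_le_mul_of_nonneg_left ?_ hC
    unfold heatDerInt
    rw [← integral_const_mul, ← integral_const_mul, ← integral_add i2 i3, ← integral_const_mul]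
    refine setIntegral_mono_on (i2.add i3) ((integrableOn_gaussMaj n x ht).const_mul _)
      measurableSet_Ioi fun s hs => ?_
    have hs : 0 < s := hs
    exact heatDer_le_gaussMaj n x (by linarith)
  rw [Real.enorm_eq_ofReal_abs, oseenMaj, ← ofReal_integral_eq_lintegral_ofReal
    (integrableOn_gaussMaj n x ht), ← ENNReal.ofReal_mul (by positivity)]
  · exact ENNReal.ofReal_le_ofReal h1
  · refine (ae_restrict_mem measurableSet_Ioi).mono fun s hs => ?_
    have hs : 0 < s := hs
    exact gaussMaj_nonneg n x (by linarith)

lemma lintegral_add_rpow_Ioi {a t : ℝ} (ha : a < -1) (ht : 0 < t) :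
    ∫⁻ s in Set.Ioi (0 : ℝ), ENNReal.ofReal ((s + t) ^ a) =
      ENNReal.ofReal ((-(a + 1))⁻¹ * t ^ (a + 1)) := by
  have h := (measurePreserving_add_right volume t).setLIntegral_comp_preimage
    (measurableSet_Ioi (a := t)) (f := fun s : ℝ => ENNReal.ofReal (s ^ a)) (by fun_prop)
  rw [Set.preimage_add_const_Ioi, sub_self] at h
  rw [h, ← ofReal_integral_eq_lintegral_ofReal (integrableOn_Ioi_rpow_of_lt ha ht)]
  · rw [integral_Ioi_rpow_of_lt ha ht, inv_neg, neg_div, div_eq_inv_mul, neg_mul]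
  · refine (ae_restrict_mem measurableSet_Ioi).mono fun s hs => ?_
    have hs : 0 < s := ht.trans hs
    positivity

lemma gaussMaj_eq_heatKer (n : ℕ) (x : Euc n) {σ : ℝ} (hσ : 0 < σ) :
    gaussMaj n x σ =
      (8 * π) ^ ((n : ℝ) / 2) * σ ^ (-(3 : ℝ) / 2) * heatKer n x (2 * σ) := by
  unfold gaussMaj heatKer
  rw [show 4 * π * (2 * σ) = (8 * π) * σ by ring, show 4 * (2 * σ) = 8 * σ by ring,
    Real.mul_rpow (by positivity) hσ.le,
    show -((n : ℝ) + 3) / 2 = -(3 : ℝ) / 2 + -(n : ℝ) / 2 by ring, Real.rpow_add hσ]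
  have h : (8 * π) ^ ((n : ℝ) / 2) * (8 * π) ^ (-(n : ℝ) / 2) = 1 := by
    rw [← Real.rpow_add (by positivity), show (n : ℝ) / 2 + -(n : ℝ) / 2 = 0 by ring,
      Real.rpow_zero]
  linear_combination (-(σ ^ (-(3 : ℝ) / 2) * σ ^ (-(n : ℝ) / 2) *
    Real.exp (-‖x‖ ^ 2 / (8 * σ)))) * h

lemma measurable_gaussMaj_shift (n : ℕ) : Measurable
    fun z : (Euc n × ℝ) × ℝ => ENNReal.ofReal (gaussMaj n z.1.1 (z.2 + z.1.2)) :=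
  ((measurable_gaussMaj n).comp
    (by fun_prop : Measurable fun z : (Euc n × ℝ) × ℝ => (z.1.1, z.2 + z.1.2))).ennreal_ofReal

lemma measurable_oseenMaj (n : ℕ) : Measurable fun z : Euc n × ℝ => oseenMaj n z.1 z.2 :=
  (measurable_gaussMaj_shift n).lintegral_prod_right'

lemma lintegral_gaussMaj (n : ℕ) {σ : ℝ} (hσ : 0 < σ) :
    ∫⁻ x : Euc n, ENNReal.ofReal (gaussMaj n x σ) =
      ENNReal.ofReal ((8 * π) ^ ((n : ℝ) / 2) * σ ^ (-(3 : ℝ) / 2)) := by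
  have h2 : 0 < 2 * σ := by positivity
  simp_rw [gaussMaj_eq_heatKer n _ hσ]
  rw [← ofReal_integral_eq_lintegral_ofReal ((integrable_heatKer n h2).const_mul _)
    (Eventually.of_forall fun x => mul_nonneg (by positivity) (heatKer_nonneg n x h2)),
    integral_const_mul, integral_heatKer n h2, mul_one]

lemma lintegral_oseenMaj (n : ℕ) {t : ℝ} (ht : 0 < t) :
    ∫⁻ x : Euc n, oseenMaj n x t =
      ENNReal.ofReal (2 * (8 * π) ^ ((n : ℝ) / 2) * t ^ (-(1 : ℝ) / 2)) := by
  unfold oseenMaj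
  have hm : Measurable (Function.uncurry fun (x : Euc n) (s : ℝ) =>
      ENNReal.ofReal (gaussMaj n x (s + t))) := (measurable_gaussMaj_shift n).comp
    (by fun_prop : Measurable fun z : Euc n × ℝ => ((z.1, t), z.2))
  rw [lintegral_lintegral_swap hm.aemeasurable]
  rw [setLIntegral_congr_fun (g := fun s => ENNReal.ofReal ((8 * π) ^ ((n : ℝ) / 2)) *
    ENNReal.ofReal ((s + t) ^ (-(3 : ℝ) / 2))) measurableSet_Ioi, lintegral_const_mul,
    lintegral_add_rpow_Ioi (by norm_num) ht, ← ENNReal.ofReal_mul (by positivity)]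
  · norm_num
    congr 1
    ring
  · fun_prop
  · intro s hs
    have hs : 0 < s := hs
    beta_reduce
    rw [← ENNReal.ofReal_mul (by positivity), lintegral_gaussMaj n (by linarith : 0 < s + t)]

lemma oseenMaj_le (n : ℕ) (x : Euc n) {t : ℝ} (ht : 0 < t) :
    oseenMaj n x t ≤ ENNReal.ofReal (2 / (n + 1) * t ^ (-((n : ℝ) + 1) / 2)) := by
  have hn' : (0 : ℝ) ≤ n := by positivity
  have h := lintegral_add_rpow_Ioi (a := -((n : ℝ) + 3) / 2) (by linarith) ht
  calc oseenMaj n x t ≤ ∫⁻ s in Set.Ioi (0 : ℝ),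
        ENNReal.ofReal ((s + t) ^ (-((n : ℝ) + 3) / 2)) := by
        refine setLIntegral_mono' measurableSet_Ioi fun s hs => ENNReal.ofReal_le_ofReal ?_
        have hs : 0 < s := hs
        have hst : 0 < s + t := by linarith
        exact mul_le_of_le_one_right (by positivity)
          (Real.exp_le_one_iff.2 (div_nonpos_of_nonpos_of_nonneg (by simp) (by positivity)))
    _ = _ := by
        rw [h]
        congr 2
        · rw [show -(-((n : ℝ) + 3) / 2 + 1) = (n + 1) / 2 by ring, inv_div]
        · congr 1
          ring

/-- The `L^r` norm of the majorant of the derivative of the Oseen kernel. -/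
lemma lintegral_oseenMaj_rpow_le (n : ℕ) {r : ℝ} (hr : 1 ≤ r) : ∃ C : ℝ, 0 < C ∧
    ∀ t : ℝ, 0 < t → (∫⁻ x : Euc n, oseenMaj n x t ^ r) ^ (1 / r) ≤
      ENNReal.ofReal (C * t ^ (-((n : ℝ) + 1) / 2 * (1 - 1 / r) - 1 / 2 * (1 / r))) := by
  have hr0 : 0 < r := by linarith
  set S : ℝ := 2 / (n + 1)
  set I : ℝ := 2 * (8 * π) ^ ((n : ℝ) / 2)
  have hS : 0 < S := by positivity
  have hI : 0 < I := by positivity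
  refine ⟨S ^ (1 - 1 / r) * I ^ (1 / r), by positivity, fun t ht => ?_⟩
  have h1 : ∫⁻ x : Euc n, oseenMaj n x t ^ r ≤
      ENNReal.ofReal (S * t ^ (-((n : ℝ) + 1) / 2)) ^ (r - 1) *
        ENNReal.ofReal (I * t ^ (-(1 : ℝ) / 2)) := by
    have hm : Measurable fun x : Euc n => oseenMaj n x t := (measurable_oseenMaj n).comp
      (by fun_prop : Measurable fun x : Euc n => (x, t))
    rw [← lintegral_oseenMaj n ht, ← lintegral_const_mul _ hm]
    refine lintegral_mono fun x => ?_
    have e : oseenMaj n x t ^ r = oseenMaj n x t ^ (r - 1) * oseenMaj n x t := by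
      conv_rhs => rw [← ENNReal.rpow_one (oseenMaj n x t), ← ENNReal.rpow_mul, one_mul,
        ← ENNReal.rpow_add_of_nonneg _ _ (by linarith) zero_le_one, sub_add_cancel]
    rw [e]
    gcongr
    exact oseenMaj_le n x ht
  refine (ENNReal.rpow_le_rpow h1 (by positivity)).trans (le_of_eq ?_)
  rw [ENNReal.ofReal_rpow_of_nonneg (by positivity) (by linarith),
    ← ENNReal.ofReal_mul (by positivity), ENNReal.ofReal_rpow_of_nonneg (by positivity)
    (by positivity)]
  congr 1
  rw [Real.mul_rpow (by positivity) (by positivity), ← Real.rpow_mul (by positivity),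
    Real.mul_rpow (by positivity) (by positivity), Real.mul_rpow (by positivity) (by positivity),
    ← Real.rpow_mul ht.le, ← Real.rpow_mul ht.le, sub_eq_add_neg _ (1 / 2 * (1 / r)),
    Real.rpow_add ht, show (r - 1) * (1 / r) = 1 - 1 / r by field_simp,
    show -(1 : ℝ) / 2 * (1 / r) = -(1 / 2 * (1 / r)) by ring]
  ring

/-- Majorant of the time density of the Duhamel term at the point `(x, t)`. -/
def duhamelMaj (n : ℕ) (u : Euc n → ℝ → Euc n) (x : Euc n) (t s : ℝ) : ENNReal :=
  ∫⁻ y : Euc n, oseenMaj n (x - y) (t - s) * ‖u y s‖ₑ ^ 2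

lemma enorm_le_sum_enorm_coord {n : ℕ} (v : Euc n) : ‖v‖ₑ ≤ ∑ i, ‖v i‖ₑ := by
  have h : v = ∑ i, EuclideanSpace.single i (v i) := by
    ext j
    simp [Pi.single_apply]
  calc ‖v‖ₑ = ‖∑ i, EuclideanSpace.single i (v i)‖ₑ := by rw [← h]
    _ ≤ ∑ i, ‖EuclideanSpace.single i (v i)‖ₑ := enorm_sum_le _ _
    _ = _ := by simp [← ofReal_norm]

lemma enorm_coord_le {n : ℕ} (v : Euc n) (i : Fin n) : ‖v i‖ₑ ≤ ‖v‖ₑ := by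
  rw [← ofReal_norm, ← ofReal_norm]
  exact ENNReal.ofReal_le_ofReal (abs_coord_le v i)

lemma enorm_integral_heatKer_mul_le {n : ℕ} {u₀ : Euc n → Euc n} {N : ℝ}
    (hN : ∀ x, ‖u₀ x‖ ≤ N) (x : Euc n) {t : ℝ} (ht : 0 < t) (i : Fin n) :
    ‖∫ y : Euc n, heatKer n (x - y) t * u₀ y i‖ₑ ≤ ENNReal.ofReal N := by
  rw [← ofReal_norm]
  refine ENNReal.ofReal_le_ofReal ?_
  calc _ ≤ ∫ y : Euc n, heatKer n (x - y) t * N := by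
        refine norm_integral_le_of_norm_le ((integrable_heatKer_sub n x ht).mul_const N)
          (Eventually.of_forall fun y => ?_)
        rw [norm_mul, Real.norm_of_nonneg (heatKer_nonneg n _ ht)]
        exact mul_le_mul_of_nonneg_left ((abs_coord_le _ i).trans (hN y)) (heatKer_nonneg n _ ht)
    _ = N := by rw [integral_mul_const, integral_heatKer_sub n x ht, one_mul]

lemma exists_enorm_mild_le {n : ℕ} (hn : 2 ≤ n) : ∃ K : ℝ, 0 < K ∧
    ∀ (T : ℝ) (u₀ : Euc n → Euc n) (u : Euc n → ℝ → Euc n) (N : ℝ), (∀ x, ‖u₀ x‖ ≤ N) →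
      IsMildNS n 0 T u₀ u → ∀ x, ∀ t ∈ Set.Ioo 0 T, ‖u x t‖ₑ ≤
        ENNReal.ofReal (n * N) + ENNReal.ofReal K * ∫⁻ s in Set.Ioo 0 t, duhamelMaj n u x t s := by
  obtain ⟨C, hC, hK⟩ := enorm_Kten_le hn
  refine ⟨(n * (n * n * C)).toReal + 1, by positivity, fun T u₀ u N hN hu x t ht => ?_⟩
  have hcoord : ∀ i, ‖u x t i‖ₑ ≤ ENNReal.ofReal N +
      (n * n * C) * ∫⁻ s in Set.Ioo 0 t, duhamelMaj n u x t s := by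
    intro i
    rw [hu x t ht i, sub_zero]
    refine (enorm_sub_le).trans (add_le_add (enorm_integral_heatKer_mul_le hN x ht.1 i) ?_)
    refine (enorm_integral_le_lintegral_enorm _).trans ?_
    rw [← lintegral_const_mul' _ _ (by finiteness)]
    refine setLIntegral_mono' measurableSet_Ioo fun s hs => ?_
    refine (enorm_integral_le_lintegral_enorm _).trans ?_
    rw [duhamelMaj, ← lintegral_const_mul' _ _ (by finiteness)]
    refine lintegral_mono fun y => ?_
    refine (enorm_sum_le _ _).trans ?_
    refine (Finset.sum_le_sum fun j _ => enorm_sum_le _ _).trans ?_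
    calc _ ≤ ∑ j : Fin n, ∑ k : Fin n,
          C * oseenMaj n (x - y) (t - s) * ‖u y s‖ₑ * ‖u y s‖ₑ := by
          refine Finset.sum_le_sum fun j _ => Finset.sum_le_sum fun k _ => ?_
          rw [enorm_mul, enorm_mul]
          gcongr
          exacts [hK i j k _ _ (sub_pos.2 hs.2), enorm_coord_le _ _, enorm_coord_le _ _]
      _ = _ := by simp; ring
  calc ‖u x t‖ₑ ≤ ∑ i, ‖u x t i‖ₑ := enorm_le_sum_enorm_coord _
    _ ≤ ∑ _i : Fin n, (ENNReal.ofReal N +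
        (n * n * C) * ∫⁻ s in Set.Ioo 0 t, duhamelMaj n u x t s) :=
        Finset.sum_le_sum fun i _ => hcoord i
    _ = ENNReal.ofReal (n * N) +
        (n * (n * n * C)) * ∫⁻ s in Set.Ioo 0 t, duhamelMaj n u x t s := by
        rw [Finset.sum_const, Finset.card_univ, Fintype.card_fin, nsmul_eq_mul, mul_add,
          ENNReal.ofReal_mul (by positivity), ENNReal.ofReal_natCast]
        ring
    _ ≤ _ := by
        gcongr
        calc _ = ENNReal.ofReal (n * (n * n * C)).toReal :=
              (ENNReal.ofReal_toReal (by finiteness)).symm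
          _ ≤ _ := ENNReal.ofReal_le_ofReal (by linarith)

lemma duhamelMaj_le_of_bound {n : ℕ} {u : Euc n → ℝ → Euc n} {M : ℝ} (x : Euc n) {t s : ℝ}
    (hst : s < t) (hM : ∀ y, ‖u y s‖ ≤ M) :
    duhamelMaj n u x t s ≤
      ENNReal.ofReal (M ^ 2 * (2 * (8 * π) ^ ((n : ℝ) / 2))) *
        ENNReal.ofReal ((t - s) ^ (-(1 : ℝ) / 2)) := by
  have hM0 : 0 ≤ M := (norm_nonneg _).trans (hM 0)
  calc duhamelMaj n u x t s
      ≤ ∫⁻ y : Euc n, oseenMaj n (x - y) (t - s) * ENNReal.ofReal (M ^ 2) := by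
        refine lintegral_mono fun y => ?_
        rw [← ofReal_norm, ← ENNReal.ofReal_pow (norm_nonneg _)]
        gcongr
        exact hM y
    _ = _ := by
        rw [lintegral_mul_const' _ _ ENNReal.ofReal_ne_top,
          lintegral_sub_left_eq_self (fun y => oseenMaj n y (t - s)),
          lintegral_oseenMaj n (sub_pos.2 hst), ← ENNReal.ofReal_mul (by positivity),
          ← ENNReal.ofReal_mul (by positivity)]
        congr 1
        ring

lemma exists_duhamelMaj_le_eLpNorm (n : ℕ) {p : ℝ} (hp : 2 < p) : ∃ C : ℝ, 0 < C ∧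
    ∀ u : Euc n → ℝ → Euc n, Measurable (fun q : Euc n × ℝ => u q.1 q.2) →
      ∀ (x : Euc n) (t s : ℝ), s < t → duhamelMaj n u x t s ≤
        ENNReal.ofReal (C * (t - s) ^ (-(1 : ℝ) / 2 - n / p)) *
          eLpNorm (fun y => u y s) (ENNReal.ofReal p) volume ^ 2 := by
  have hp2 : 0 < p - 2 := by linarith
  have hp0 : 0 < p := by linarith
  have hconj : (p / (p - 2)).HolderConjugate (p / 2) := by
    rw [Real.holderConjugate_iff]
    refine ⟨by rw [lt_div_iff₀ hp2]; linarith, ?_⟩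
    field_simp
    ring
  obtain ⟨C, hC, h⟩ := lintegral_oseenMaj_rpow_le n hconj.lt.le
  refine ⟨C, hC, fun u hu x t s hst => ?_⟩
  have hus : Measurable fun y => u y s :=
    hu.comp (by fun_prop : Measurable fun y : Euc n => (y, s))
  have hm : Measurable fun y : Euc n => oseenMaj n (x - y) (t - s) := (measurable_oseenMaj n).comp
    (by fun_prop : Measurable fun y : Euc n => (x - y, t - s))
  refine (ENNReal.lintegral_mul_le_Lp_mul_Lq volume hconj hm.aemeasurable
    (hus.enorm.pow_const 2).aemeasurable).trans (le_of_le_of_eq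
      (mul_le_mul_left ((le_of_eq ?_).trans (h (t - s) (sub_pos.2 hst))) _) ?_)
  · rw [lintegral_sub_left_eq_self (fun y => oseenMaj n y (t - s) ^ (p / (p - 2)))]
  · congr 1
    · congr 3
      field_simp
      ring
    · rw [eLpNorm_eq_lintegral_rpow_enorm_toReal (by simpa using hp0) ENNReal.ofReal_ne_top,
        ENNReal.toReal_ofReal hp0.le, ← ENNReal.rpow_natCast, ← ENNReal.rpow_mul]
      congr 1
      · refine lintegral_congr fun y => ?_
        rw [← ENNReal.rpow_natCast, ← ENNReal.rpow_mul]
        congr 1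
        push_cast
        ring
      · push_cast
        field_simp

lemma lintegral_sub_rpow_Ioo {a t : ℝ} (hat : a ≤ t) :
    ∫⁻ s in Set.Ioo a t, ENNReal.ofReal ((t - s) ^ (-(1 : ℝ) / 2)) =
      ENNReal.ofReal (2 * √(t - a)) := by
  have h := (Measure.measurePreserving_sub_left volume t).setLIntegral_comp_preimage
    (measurableSet_Ioo (a := 0) (b := t - a))
    (f := fun s : ℝ => ENNReal.ofReal (s ^ (-(1 : ℝ) / 2))) (by fun_prop)
  rw [Set.preimage_const_sub_Ioo, sub_sub_cancel, sub_zero] at h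
  have hi : IntegrableOn (fun s : ℝ => s ^ (-(1 : ℝ) / 2)) (Set.Ioo 0 (t - a)) := by
    rw [← integrableOn_Ioc_iff_integrableOn_Ioo,
      ← intervalIntegrable_iff_integrableOn_Ioc_of_le (by linarith)]
    exact intervalIntegral.intervalIntegrable_rpow' (by norm_num)
  rw [h, ← ofReal_integral_eq_lintegral_ofReal hi, ← integral_Ioc_eq_integral_Ioo,
    ← intervalIntegral.integral_of_le (by linarith), integral_rpow (Or.inl (by norm_num)),
    Real.sqrt_eq_rpow]
  · congr 1
    rw [show -(1 : ℝ) / 2 + 1 = 1 / 2 by norm_num, Real.zero_rpow (by norm_num)]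
    ring
  · refine (ae_restrict_mem measurableSet_Ioo).mono fun s hs => ?_
    have := hs.1
    positivity

lemma lintegral_sub_rpow_Iio {a t δ : ℝ} (ha : a < -1) (hδ : 0 < δ) :
    ∫⁻ s in Set.Iio (t - δ), ENNReal.ofReal ((t - s) ^ a) =
      ENNReal.ofReal ((-(a + 1))⁻¹ * δ ^ (a + 1)) := by
  have h := (Measure.measurePreserving_sub_left volume (t - δ)).setLIntegral_comp_preimage
    (measurableSet_Ioi (a := 0))
    (f := fun s : ℝ => ENNReal.ofReal ((s + δ) ^ a)) (by fun_prop)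
  rw [Set.preimage_const_sub_Ioi, sub_zero, lintegral_add_rpow_Ioi ha hδ] at h
  rw [← h]
  refine lintegral_congr fun s => ?_
  congr 2
  ring

lemma measurable_eLpNorm_slice {n : ℕ} {u : Euc n → ℝ → Euc n} {p : ℝ} (hp : 0 < p)
    (hu : Measurable (fun q : Euc n × ℝ => u q.1 q.2)) :
    Measurable fun s => eLpNorm (fun y => u y s) (ENNReal.ofReal p) volume := by
  simp_rw [eLpNorm_eq_lintegral_rpow_enorm_toReal (p := ENNReal.ofReal p) (by simpa using hp)
    ENNReal.ofReal_ne_top]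
  exact ((hu.enorm.pow_const _).lintegral_prod_left' (μ := volume)).pow_const _

lemma exists_lintegral_duhamelMaj_le {n : ℕ} (hn : 2 ≤ n) {p q : ℝ} (hp : 1 < p) (hq : 1 < q)
    (hpq : (n : ℝ) / p + 2 / q = 1) : ∃ C : ℝ, 0 < C ∧
    ∀ u : Euc n → ℝ → Euc n, Measurable (fun q : Euc n × ℝ => u q.1 q.2) →
      ∀ (x : Euc n) (t δ : ℝ), 0 < δ → ∀ S ⊆ Set.Iio (t - δ), MeasurableSet S →
        ∫⁻ s in S, duhamelMaj n u x t s ≤ ENNReal.ofReal (C * (√δ)⁻¹) *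
          (∫⁻ s in S, eLpNorm (fun y => u y s) (ENNReal.ofReal p) volume ^ q) ^ (2 / q) := by
  have hn' : (2 : ℝ) ≤ n := by exact_mod_cast hn
  have hp0 : 0 < p := by linarith
  have hq0 : 0 < q := by linarith
  have hp2 : 2 < p := by
    have h1 : (n : ℝ) / p < 1 := by have : 0 < 2 / q := by positivity
                                    linarith
    rw [div_lt_one hp0] at h1
    linarith
  have hq2 : 2 < q := by
    have h1 : 2 / q < 1 := by have : 0 < (n : ℝ) / p := by positivity
                              linarith
    rwa [div_lt_one hq0] at h1
  have hq2' : 0 < q - 2 := by linarith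
  obtain ⟨C, hC, h⟩ := exists_duhamelMaj_le_eLpNorm n hp2
  set b : ℝ := -(1 : ℝ) / 2 - n / p with hb
  set Q : ℝ := q / (q - 2) with hQ
  have hconj : Q.HolderConjugate (q / 2) := by
    rw [Real.holderConjugate_iff]
    refine ⟨by rw [lt_div_iff₀ hq2']; linarith, ?_⟩
    rw [hQ]
    field_simp
    ring
  have hQ0 : 0 < Q := hconj.pos
  have hQinv : 1 / Q = 1 - 2 / q := by rw [hQ]; field_simp
  have hbQ : (b * Q + 1) * (1 / Q) = -(1 / 2) := by
    have : (b * Q + 1) * (1 / Q) = b + 1 / Q := by field_simp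
    rw [this, hQinv, hb]
    linarith
  have hbQ1 : b * Q < -1 := by
    have : b * Q + 1 < 0 := by
      by_contra hcon
      have := mul_nonneg (not_lt.1 hcon) (by positivity : 0 ≤ 1 / Q)
      linarith
    linarith
  set D : ℝ := (-(b * Q + 1))⁻¹ with hD
  have hD0 : 0 < D := inv_pos.2 (by linarith)
  refine ⟨C * D ^ (1 / Q), by positivity, fun u hu x t δ hδ S hS hSm => ?_⟩
  calc ∫⁻ s in S, duhamelMaj n u x t s
      ≤ ∫⁻ s in S, ENNReal.ofReal C * (ENNReal.ofReal ((t - s) ^ b) *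
          eLpNorm (fun y => u y s) (ENNReal.ofReal p) volume ^ 2) := by
        refine setLIntegral_mono' hSm fun s hs => ?_
        have hs : s < t - δ := hS hs
        refine (h u hu x t s (by linarith)).trans (le_of_eq ?_)
        rw [ENNReal.ofReal_mul hC.le, mul_assoc]
    _ = ENNReal.ofReal C * ∫⁻ s in S, ENNReal.ofReal ((t - s) ^ b) *
          eLpNorm (fun y => u y s) (ENNReal.ofReal p) volume ^ 2 :=
        lintegral_const_mul' _ _ ENNReal.ofReal_ne_top
    _ ≤ ENNReal.ofReal C * ((∫⁻ s in S, ENNReal.ofReal ((t - s) ^ b) ^ Q) ^ (1 / Q) *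
          (∫⁻ s in S, (eLpNorm (fun y => u y s) (ENNReal.ofReal p) volume ^ 2) ^ (q / 2)) ^
            (1 / (q / 2))) := by
        gcongr
        exact ENNReal.lintegral_mul_le_Lp_mul_Lq _ hconj (by fun_prop)
          ((measurable_eLpNorm_slice hp0 hu).pow_const 2).aemeasurable
    _ ≤ ENNReal.ofReal C * (ENNReal.ofReal (D * δ ^ (b * Q + 1)) ^ (1 / Q) *
          (∫⁻ s in S, eLpNorm (fun y => u y s) (ENNReal.ofReal p) volume ^ q) ^ (2 / q)) := by
        gcongr
        · rw [← lintegral_sub_rpow_Iio hbQ1 hδ]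
          refine (lintegral_mono_set hS).trans_eq' ?_
          refine setLIntegral_congr_fun hSm fun s hs => ?_
          have hs : s < t - δ := hS hs
          have hts : 0 < t - s := by linarith
          rw [ENNReal.ofReal_rpow_of_nonneg (by positivity) hQ0.le, ← Real.rpow_mul hts.le]
        · refine le_of_eq ?_
          congr 1
          · refine lintegral_congr fun s => ?_
            rw [← ENNReal.rpow_natCast, ← ENNReal.rpow_mul]
            congr 1
            push_cast
            ring
          · rw [one_div_div]
    _ = _ := by
        rw [ENNReal.ofReal_rpow_of_nonneg (by positivity) (by positivity), ← mul_assoc,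
          ← ENNReal.ofReal_mul hC.le, Real.mul_rpow hD0.le (by positivity),
          ← Real.rpow_mul hδ.le, hbQ, Real.rpow_neg hδ.le, Real.sqrt_eq_rpow]
        congr 2
        ring

lemma lintegral_duhamelMaj_le_of_bound {n : ℕ} {u : Euc n → ℝ → Euc n} {M a t : ℝ}
    (x : Euc n) (hat : a ≤ t) {S : Set ℝ} (hSm : MeasurableSet S) (hS : S ⊆ Set.Ioo a t)
    (hM : ∀ s ∈ S, ∀ y, ‖u y s‖ ≤ M) :
    ∫⁻ s in S, duhamelMaj n u x t s ≤
      ENNReal.ofReal (M ^ 2 * (2 * (8 * π) ^ ((n : ℝ) / 2)) * (2 * √(t - a))) := by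
  calc ∫⁻ s in S, duhamelMaj n u x t s ≤ ∫⁻ s in S,
        ENNReal.ofReal (M ^ 2 * (2 * (8 * π) ^ ((n : ℝ) / 2))) *
          ENNReal.ofReal ((t - s) ^ (-(1 : ℝ) / 2)) :=
        setLIntegral_mono' hSm fun s hs => duhamelMaj_le_of_bound x (hS hs).2 (hM s hs)
    _ ≤ ∫⁻ s in Set.Ioo a t, ENNReal.ofReal (M ^ 2 * (2 * (8 * π) ^ ((n : ℝ) / 2))) *
          ENNReal.ofReal ((t - s) ^ (-(1 : ℝ) / 2)) := lintegral_mono_set hS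
    _ = _ := by
        rw [lintegral_const_mul' _ _ ENNReal.ofReal_ne_top, lintegral_sub_rpow_Ioo hat,
          ← ENNReal.ofReal_mul (by positivity)]

lemma lintegral_Ioo_le_add_add (f : ℝ → ENNReal) {t T : ℝ} (htT : t ≤ T) (a b : ℝ) :
    ∫⁻ s in Set.Ioo 0 t, f s ≤ (∫⁻ s in Set.Ioo 0 t ∩ Set.Iic a, f s) +
      (∫⁻ s in Set.Ioo a T ∩ Set.Iio b, f s) + ∫⁻ s in Set.Ioo 0 t ∩ Set.Ioo b t, f s := by
  have hsub : Set.Ioo 0 t ≤ᵐ[volume] ((Set.Ioo 0 t ∩ Set.Iic a) ∪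
      (Set.Ioo a T ∩ Set.Iio b) ∪ (Set.Ioo 0 t ∩ Set.Ioo b t) : Set ℝ) := by
    filter_upwards [compl_mem_ae_iff.2 (measure_singleton b)] with s hs hst
    have hst : s ∈ Set.Ioo 0 t := hst
    rcases le_or_gt s a with h1 | h1
    · exact Or.inl (Or.inl ⟨hst, h1⟩)
    rcases lt_or_gt_of_ne hs with h2 | h2
    · exact Or.inl (Or.inr ⟨⟨h1, hst.2.trans_le htT⟩, h2⟩)
    · exact Or.inr ⟨hst, h2, hst.2⟩
  refine (lintegral_mono' (Measure.restrict_mono_ae hsub) le_rfl).trans ?_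
  exact (lintegral_union_le _ _ _).trans (by gcongr; exact lintegral_union_le _ _ _)

/-- If the Ladyzhenskaya–Prodi–Serrin norm is finite, a bound `L` of the solution on any
subinterval improves to `C₀ + L / 2`, with `C₀` independent of the subinterval. -/
lemma exists_bound_add_half {n : ℕ} (hn : 2 ≤ n) {T : ℝ} (hT : 0 < T)
    {u₀ : Euc n → Euc n} {u : Euc n → ℝ → Euc n} (hbd0 : ∃ N : ℝ, ∀ x : Euc n, ‖u₀ x‖ ≤ N)
    (hmeas : Measurable (fun q : Euc n × ℝ => u q.1 q.2))
    (hmild : IsMildNS n 0 T u₀ u)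
    (hlocbd : ∀ T' ∈ Set.Ioo (0:ℝ) T, ∃ M : ℝ, ∀ x : Euc n,
      ∀ t ∈ Set.Ioo (0:ℝ) T', ‖u x t‖ ≤ M)
    {p q : ℝ} (hp : 1 < p) (hq : 1 < q) (hpq : (n : ℝ) / p + 2 / q = 1)
    (hfin : ∫⁻ t in Set.Ioo (0:ℝ) T,
      (eLpNorm (fun x => u x t) (ENNReal.ofReal p) volume) ^ q ≠ ⊤) :
    ∃ C₀ : ℝ, 1 ≤ C₀ ∧ ∀ T' ∈ Set.Ioo (0:ℝ) T, ∀ L : ℝ, 0 < L →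
      (∀ x : Euc n, ∀ t ∈ Set.Ioo (0:ℝ) T', ‖u x t‖ ≤ L) →
      ∀ x : Euc n, ∀ t ∈ Set.Ioo (0:ℝ) T', ‖u x t‖ ≤ C₀ + L / 2 := by
  obtain ⟨N, hN⟩ := hbd0
  have hN0 : 0 ≤ N := (norm_nonneg _).trans (hN 0)
  have hq0 : 0 < q := by linarith
  obtain ⟨K, hK, hmaj⟩ := exists_enorm_mild_le hn
  obtain ⟨C, hC, hLp⟩ := exists_lintegral_duhamelMaj_le hn hp hq hpq
  set I : ℝ := 2 * (8 * π) ^ ((n : ℝ) / 2) with hI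
  have hI0 : 0 < I := by positivity
  set c : ℝ := (8 * K * I)⁻¹ with hc
  have hc0 : 0 < c := by positivity
  set ε : ℝ := c / (4 * K * C) with hε
  have hε0 : 0 < ε := by positivity
  obtain ⟨η₀, hη₀, hsmall⟩ := exists_pos_setLIntegral_lt_of_measure_lt hfin
    (ε := ENNReal.ofReal (ε ^ (q / 2))) (by simp; positivity)
  obtain ⟨η₁, hη₁, hη₁'⟩ : ∃ η₁ : ℝ, 0 < η₁ ∧ ENNReal.ofReal η₁ < η₀ := by
    obtain ⟨r, hr, hr'⟩ := ENNReal.lt_iff_exists_nnreal_btwn.1 hη₀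
    exact ⟨r, by exact_mod_cast hr, by simpa using hr'⟩
  set η : ℝ := min η₁ (T / 2) with hη
  have hη0 : 0 < η := by positivity
  have hηT : η ≤ T / 2 := min_le_right _ _
  obtain ⟨M, hM⟩ := hlocbd (T - η / 2) ⟨by linarith, by linarith⟩
  have hend : ∀ S ⊆ Set.Ioo (T - η) T, MeasurableSet S →
      (∫⁻ s in S, eLpNorm (fun y => u y s) (ENNReal.ofReal p) volume ^ q) ^ (2 / q) ≤
        ENNReal.ofReal ε := by
    intro S hS hSm
    have h1 : ∫⁻ s in S, eLpNorm (fun y => u y s) (ENNReal.ofReal p) volume ^ q ≤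
        ENNReal.ofReal (ε ^ (q / 2)) := by
      have hlt : (volume.restrict (Set.Ioo 0 T)) S < η₀ := by
        refine ((Measure.restrict_apply_le _ _).trans (measure_mono hS)).trans_lt ?_
        rw [Real.volume_Ioo, sub_sub_cancel]
        exact (ENNReal.ofReal_le_ofReal (min_le_left _ _)).trans_lt hη₁'
      have h2 := hsmall S hlt
      rw [Measure.restrict_restrict hSm, Set.inter_eq_left.2
        (hS.trans (Set.Ioo_subset_Ioo_left (by linarith)))] at h2
      exact h2.le
    refine (ENNReal.rpow_le_rpow h1 (by positivity)).trans (le_of_eq ?_)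
    rw [ENNReal.ofReal_rpow_of_nonneg (by positivity) (by positivity), ← Real.rpow_mul hε0.le,
      show q / 2 * (2 / q) = 1 by field_simp, Real.rpow_one]
  refine ⟨n * N + K * (M ^ 2 * I * (2 * √T)) + 1,
    by have : 0 ≤ n * N + K * (M ^ 2 * I * (2 * √T)) := by positivity
       linarith, fun T' hT' L hL hbd x t ht => ?_⟩
  have htT : t < T := ht.2.trans hT'.2
  set δ : ℝ := (c / L) ^ 2 with hδ
  have hδ0 : 0 < δ := by positivity
  have hsδ : √δ = c / L := Real.sqrt_sq (by positivity)
  have hA := lintegral_duhamelMaj_le_of_bound (n := n) (u := u) (M := M) x ht.1.le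
    (S := Set.Ioo 0 t ∩ Set.Iic (T - η)) (measurableSet_Ioo.inter measurableSet_Iic)
    Set.inter_subset_left fun s hs y => hM y s
      ⟨hs.1.1, by have := Set.mem_Iic.1 hs.2; linarith⟩
  have hD := lintegral_duhamelMaj_le_of_bound (n := n) (u := u) (M := L) (a := t - δ) x
    (by linarith) (S := Set.Ioo 0 t ∩ Set.Ioo (t - δ) t) (measurableSet_Ioo.inter measurableSet_Ioo)
    Set.inter_subset_right fun s hs y => hbd y s ⟨hs.1.1, hs.1.2.trans ht.2⟩
  have hB := hLp u hmeas x t δ hδ0 (Set.Ioo (T - η) T ∩ Set.Iio (t - δ))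
    Set.inter_subset_right (measurableSet_Ioo.inter measurableSet_Iio)
  have hB' := hend (Set.Ioo (T - η) T ∩ Set.Iio (t - δ)) Set.inter_subset_left
    (measurableSet_Ioo.inter measurableSet_Iio)
  have hcover : ∫⁻ s in Set.Ioo 0 t, duhamelMaj n u x t s ≤
      ENNReal.ofReal (M ^ 2 * I * (2 * √T)) + ENNReal.ofReal (C * (√δ)⁻¹ * ε) +
        ENNReal.ofReal (L ^ 2 * I * (2 * √δ)) := by
    refine (lintegral_Ioo_le_add_add _ htT.le _ _).trans
      (add_le_add (add_le_add (hA.trans ?_) (hB.trans ?_)) (hD.trans ?_))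
    · refine ENNReal.ofReal_le_ofReal ?_
      rw [sub_zero]
      gcongr
    · rw [ENNReal.ofReal_mul (p := C * (√δ)⁻¹) (by positivity)]
      exact mul_le_mul' le_rfl hB'
    · rw [sub_sub_cancel]
  have hfinal := hmaj T u₀ u N hN hmild x t ⟨ht.1, htT⟩
  have hreal : ‖u x t‖ₑ ≤ ENNReal.ofReal (n * N + K * (M ^ 2 * I * (2 * √T) +
      C * (√δ)⁻¹ * ε + L ^ 2 * I * (2 * √δ))) := by
    refine hfinal.trans ?_
    rw [ENNReal.ofReal_add (by positivity) (by positivity), ENNReal.ofReal_mul hK.le,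
      ENNReal.ofReal_add (by positivity) (by positivity),
      ENNReal.ofReal_add (by positivity) (by positivity)]
    gcongr
  rw [← ofReal_norm, ENNReal.ofReal_le_ofReal_iff (by positivity), hsδ] at hreal
  have e1 : K * (C * (c / L)⁻¹ * ε) = L / 4 := by
    rw [hε]
    field_simp
  have e2 : K * (L ^ 2 * I * (2 * (c / L))) = L / 4 := by
    rw [hc]
    field_simp
    norm_num
  linarith

lemma exists_bound_of_add_half {ι : Type*} {f : ι → ℝ} {C₀ : ℝ} (hC₀ : 1 ≤ C₀)
    (hbd : ∃ M, ∀ i, f i ≤ M)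
    (h : ∀ L : ℝ, 0 < L → (∀ i, f i ≤ L) → ∀ i, f i ≤ C₀ + L / 2) (i : ι) : f i ≤ 2 * C₀ := by
  obtain ⟨M, hM⟩ := hbd
  have hB : BddAbove (Set.range f) := ⟨M, by rintro _ ⟨i, rfl⟩; exact hM i⟩
  have hne : Nonempty ι := ⟨i⟩
  set L := max (⨆ i, f i) 1
  have hL : ∀ i, f i ≤ L := fun i => (le_ciSup hB i).trans (le_max_left _ _)
  have h1 : ⨆ i, f i ≤ C₀ + L / 2 := ciSup_le (h L (by positivity) hL)
  have h2 : L ≤ C₀ + L / 2 := max_le h1 (by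
    have : (1 : ℝ) ≤ L := le_max_right _ _
    linarith)
  linarith [hL i]

/-- Ladyzhenskaya–Prodi–Serrin criterion via ancient solutions: if a mild solution blows
up at a finite time T, then for every p, q ∈ (1,∞) with n/p + 2/q = 1 the
L^q_t L^p_x-norm of u on ℝⁿ × (0,T) is infinite. -/
theorem lps_norm_blowup (n : ℕ) (hn : 2 ≤ n) (T : ℝ) (hT : 0 < T)
    (u₀ : Euc n → Euc n) (u : Euc n → ℝ → Euc n)
    (hmeas0 : Measurable u₀) (hbd0 : ∃ N : ℝ, ∀ x : Euc n, ‖u₀ x‖ ≤ N)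
    (hdiv : ∀ ψ : Euc n → ℝ, ContDiff ℝ (⊤ : ℕ∞) ψ → HasCompactSupport ψ →
      (∫ x : Euc n, ∑ i : Fin n, u₀ x i * pd n i ψ x) = 0)
    (hmeas : Measurable (fun q : Euc n × ℝ => u q.1 q.2))
    (hmild : IsMildNS n 0 T u₀ u)
    (hlocbd : ∀ T' ∈ Set.Ioo (0:ℝ) T, ∃ M : ℝ, ∀ x : Euc n,
      ∀ t ∈ Set.Ioo (0:ℝ) T', ‖u x t‖ ≤ M)
    (hblow : ∀ M : ℝ, ∃ x : Euc n, ∃ t ∈ Set.Ioo (0:ℝ) T, M < ‖u x t‖)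
    (p q : ℝ) (hp : 1 < p) (hq : 1 < q) (hpq : (n : ℝ) / p + 2 / q = 1) :
    ∫⁻ t in Set.Ioo (0:ℝ) T,
      (eLpNorm (fun x => u x t) (ENNReal.ofReal p) volume) ^ q = ⊤ := by
  by_contra hfin
  obtain ⟨C₀, hC₀, himp⟩ :=
    exists_bound_add_half hn hT hbd0 hmeas hmild hlocbd hp hq hpq hfin
  obtain ⟨x, t, ht, hlt⟩ := hblow (2 * C₀)
  have hT' : (t + T) / 2 ∈ Set.Ioo 0 T := ⟨by linarith [ht.1], by linarith [ht.2]⟩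
  refine hlt.not_ge (exists_bound_of_add_half
    (ι := Euc n × Set.Ioo 0 ((t + T) / 2)) (f := fun z => ‖u z.1 z.2‖) hC₀ ?_ ?_
    (x, ⟨t, ht.1, by linarith [ht.2]⟩))
  · obtain ⟨M, hM⟩ := hlocbd _ hT'
    exact ⟨M, fun z => hM z.1 z.2 z.2.2⟩
  · exact fun L hL hbd z => himp _ hT' L hL (fun x t ht => hbd (x, ⟨t, ht⟩)) z.1 z.2 z.2.2

end
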